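/- Fix 1 ≤ l ≤ n−1 and an integer K with 0 ≤ K < k, and set P_K := {−K, −K+1, …, k−K−1}. Then the R-submodule L := ⟨α_{ijl}^p·b : 1 ≤ i ≤ j ≤ l, p ∈ P_K, b ∈ B_{l−1}⟩ of B_n^k(R) is a left ideal of B_{l+1}; that is, x·y ∈ L for every x ∈ B_{l+1} and y ∈ L. -/

import Mathlib

/-!
Cyclotomic BMW algebra `B_n^k(R)`, presented as the quotient of the free `R`-algebra on
generators `Y, Y⁻¹, Xᵢ, Xᵢ⁻¹ (1 ≤ i ≤ n-1), eᵢ (1 ≤ i ≤ n-1)` by the defining relations.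
Generators with out-of-range indices are identified with `1` (resp. `0` for the `eᵢ`),
so that the quotient is exactly the cyclotomic BMW algebra.
-/

inductive BMWGen : Type
  | Y : BMWGen
  | Yinv : BMWGen
  | X : ℕ → BMWGen
  | Xinv : ℕ → BMWGen
  | E : ℕ → BMWGen

namespace CBMW

/-- The parameters of a cyclotomic BMW algebra: `n`, `k`, units `q, λ, q₀` and
families `qc` (the `qᵢ`, with `qc 0 = q₀`) and `A` (the `Aᵢ`). -/
structure Params (R : Type) [CommRing R] where
  n : ℕ
  k : ℕ
  q : Rˣ
  lam : Rˣ
  q0 : Rˣ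
  qc : ℕ → R
  A : ℕ → R

variable {R : Type} [CommRing R]

abbrev F (R : Type) [CommRing R] := FreeAlgebra R BMWGen

def fY : F R := FreeAlgebra.ι R BMWGen.Y
def fYi : F R := FreeAlgebra.ι R BMWGen.Yinv
def fX (i : ℕ) : F R := FreeAlgebra.ι R (BMWGen.X i)
def fXi (i : ℕ) : F R := FreeAlgebra.ι R (BMWGen.Xinv i)
def fE (i : ℕ) : F R := FreeAlgebra.ι R (BMWGen.E i)

/-- `δ = q - q⁻¹`. -/
def Params.delta (P : Params R) : R := (P.q : R) - ((P.q⁻¹ : Rˣ) : R)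

/-- `λ⁻¹` as an element of `R`. -/
def Params.laminv (P : Params R) : R := ((P.lam⁻¹ : Rˣ) : R)

/-- The defining relations of the cyclotomic BMW algebra. -/
inductive Rel (P : Params R) : F R → F R → Prop
  | X_inv_right {i : ℕ} (h1 : 1 ≤ i) (h2 : i ≤ P.n - 1) : Rel P (fX i * fXi i) 1
  | X_inv_left {i : ℕ} (h1 : 1 ≤ i) (h2 : i ≤ P.n - 1) : Rel P (fXi i * fX i) 1
  | Y_inv_right : Rel P (fY * fYi) 1
  | Y_inv_left : Rel P (fYi * fY) 1
  | X_invalid {i : ℕ} (h : i = 0 ∨ P.n - 1 < i) : Rel P (fX i) 1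
  | Xi_invalid {i : ℕ} (h : i = 0 ∨ P.n - 1 < i) : Rel P (fXi i) 1
  | E_invalid {i : ℕ} (h : i = 0 ∨ P.n - 1 < i) : Rel P (fE i) 0
  | skein {i : ℕ} (h1 : 1 ≤ i) (h2 : i ≤ P.n - 1) :
      Rel P (fX i - fXi i) (P.delta • ((1 : F R) - fE i))
  | XX_far {i j : ℕ} (h1 : 1 ≤ i) (h2 : i ≤ P.n - 1) (h3 : 1 ≤ j) (h4 : j ≤ P.n - 1)
      (h : i + 2 ≤ j ∨ j + 2 ≤ i) : Rel P (fX i * fX j) (fX j * fX i)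
  | braid {i : ℕ} (h1 : 1 ≤ i) (h2 : i + 1 ≤ P.n - 1) :
      Rel P (fX i * fX (i+1) * fX i) (fX (i+1) * fX i * fX (i+1))
  | XE_far {i j : ℕ} (h1 : 1 ≤ i) (h2 : i ≤ P.n - 1) (h3 : 1 ≤ j) (h4 : j ≤ P.n - 1)
      (h : i + 2 ≤ j ∨ j + 2 ≤ i) : Rel P (fX i * fE j) (fE j * fX i)
  | EE_far {i j : ℕ} (h1 : 1 ≤ i) (h2 : i ≤ P.n - 1) (h3 : 1 ≤ j) (h4 : j ≤ P.n - 1)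
      (h : i + 2 ≤ j ∨ j + 2 ≤ i) : Rel P (fE i * fE j) (fE j * fE i)
  | untwist_right {i : ℕ} (h1 : 1 ≤ i) (h2 : i ≤ P.n - 1) :
      Rel P (fX i * fE i) ((P.lam : R) • fE i)
  | untwist_left {i : ℕ} (h1 : 1 ≤ i) (h2 : i ≤ P.n - 1) :
      Rel P (fE i * fX i) ((P.lam : R) • fE i)
  | XXE {i j : ℕ} (h1 : 1 ≤ i) (h2 : i ≤ P.n - 1) (h3 : 1 ≤ j) (h4 : j ≤ P.n - 1)
      (h : j = i + 1 ∨ i = j + 1) : Rel P (fX i * fX j * fE i) (fE j * fE i)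
  | EXX {i j : ℕ} (h1 : 1 ≤ i) (h2 : i ≤ P.n - 1) (h3 : 1 ≤ j) (h4 : j ≤ P.n - 1)
      (h : j = i + 1 ∨ i = j + 1) : Rel P (fE j * fE i) (fE j * fX i * fX j)
  | EEE_up {i : ℕ} (h1 : 1 ≤ i) (h2 : i + 1 ≤ P.n - 1) :
      Rel P (fE i * fE (i+1) * fE i) (fE i)
  | EEE_down {i : ℕ} (h1 : 1 ≤ i) (h2 : i + 1 ≤ P.n - 1) :
      Rel P (fE (i+1) * fE i * fE (i+1)) (fE (i+1))
  | E_sq {i : ℕ} (h1 : 1 ≤ i) (h2 : i ≤ P.n - 1) : Rel P (fE i * fE i) (P.A 0 • fE i)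
  | cyclo : Rel P (fY ^ P.k) (∑ i ∈ Finset.range P.k, P.qc i • fY ^ i)
  | braidB (h : 2 ≤ P.n) :
      Rel P (fX 1 * fY * fX 1 * fY) (fY * fX 1 * fY * fX 1)
  | YX_comm {i : ℕ} (h1 : 2 ≤ i) (h2 : i ≤ P.n - 1) : Rel P (fY * fX i) (fX i * fY)
  | YE_comm {i : ℕ} (h1 : 2 ≤ i) (h2 : i ≤ P.n - 1) : Rel P (fY * fE i) (fE i * fY)
  | YXYE (h : 2 ≤ P.n) : Rel P (fY * fX 1 * fY * fE 1) (P.laminv • fE 1)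
  | EYXY (h : 2 ≤ P.n) : Rel P (fE 1 * (fY * fX 1 * fY)) (P.laminv • fE 1)
  | EYE {m : ℕ} (h : 2 ≤ P.n) (hm : m ≤ P.k - 1) :
      Rel P (fE 1 * fY ^ m * fE 1) (P.A m • fE 1)

/-- The cyclotomic BMW algebra `B_n^k(R)`. -/
abbrev Alg (P : Params R) := RingQuot (Rel P)

def pr (P : Params R) : F R →ₐ[R] Alg P := RingQuot.mkAlgHom R (Rel P)

/-- The generator `Y`. -/
def Yg (P : Params R) : Alg P := pr P fY
/-- The generator `Y⁻¹`. -/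
def Ygi (P : Params R) : Alg P := pr P fYi
/-- The generator `Xᵢ`. -/
def Xg (P : Params R) (i : ℕ) : Alg P := pr P (fX i)
/-- The generator `Xᵢ⁻¹`. -/
def Xgi (P : Params R) (i : ℕ) : Alg P := pr P (fXi i)
/-- The generator `eᵢ`. -/
def Eg (P : Params R) (i : ℕ) : Alg P := pr P (fE i)

/-- `X₁ X₂ ⋯ X_m`. -/
def upX (P : Params R) : ℕ → Alg P
  | 0 => 1
  | m + 1 => upX P m * Xg P (m + 1)

/-- `X_m ⋯ X₂ X₁`. -/
def downX (P : Params R) : ℕ → Alg P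
  | 0 => 1
  | m + 1 => Xg P (m + 1) * downX P m

/-- `X₁⁻¹ X₂⁻¹ ⋯ X_m⁻¹`. -/
def upXi (P : Params R) : ℕ → Alg P
  | 0 => 1
  | m + 1 => upXi P m * Xgi P (m + 1)

/-- `X_m⁻¹ ⋯ X₂⁻¹ X₁⁻¹`. -/
def downXi (P : Params R) : ℕ → Alg P
  | 0 => 1
  | m + 1 => Xgi P (m + 1) * downXi P m

/-- `Yᵢ' = X_{i-1} ⋯ X₁ Y X₁ ⋯ X_{i-1}`. -/
def Yp (P : Params R) (i : ℕ) : Alg P := downX P (i - 1) * Yg P * upX P (i - 1)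

/-- `(Yᵢ')⁻¹ = X_{i-1}⁻¹ ⋯ X₁⁻¹ Y⁻¹ X₁⁻¹ ⋯ X_{i-1}⁻¹`. -/
def YpInv (P : Params R) (i : ℕ) : Alg P := downXi P (i - 1) * Ygi P * upXi P (i - 1)

/-- `(Yᵢ')^p` for an integer exponent `p`. -/
def Ypow (P : Params R) (i : ℕ) (p : ℤ) : Alg P :=
  if 0 ≤ p then Yp P i ^ p.toNat else YpInv P i ^ (-p).toNat

/-- `Y^{s 1} (Y₂')^{s 2} ⋯ (Y_m')^{s m}`. -/
def YpowProd (P : Params R) (s : ℕ → ℤ) : ℕ → Alg P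
  | 0 => 1
  | m + 1 => YpowProd P s m * Ypow P (m + 1) (s (m + 1))

/-- The subalgebra `B_l` generated by `Y^{±1}, X₁^{±1}, …, X_{l-1}^{±1}, e₁, …, e_{l-1}`. -/
def Bsub (P : Params R) (l : ℕ) : Subalgebra R (Alg P) :=
  Algebra.adjoin R
    ({Yg P, Ygi P} ∪
      {x | ∃ i, 1 ≤ i ∧ i + 1 ≤ l ∧ (x = Xg P i ∨ x = Xgi P i ∨ x = Eg P i)})

/-- `α_{ijl}^p = (Yᵢ')^p Xᵢ ⋯ X_{j-1} e_j ⋯ e_l`. -/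
def alpha (P : Params R) (i j l : ℕ) (p : ℤ) : Alg P :=
  Ypow P i p * ((List.range' i (j - i)).map fun t => Xg P t).prod *
    ((List.range' j (l + 1 - j)).map fun t => Eg P t).prod

/-- The set `P = {⌊k/2⌋ - (k-1), …, ⌊k/2⌋}` of `k` consecutive integers. -/
def Pset (k : ℕ) : Set ℤ := {p | (↑(k / 2) : ℤ) - ((k : ℤ) - 1) ≤ p ∧ p ≤ (↑(k / 2) : ℤ)}

/-- `α_{i₁,j₁,l-1}^{s₁} ⋯ α_{i_m,j_m,l-2m+1}^{s_m}`. -/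
def alphaChain (P : Params R) (l : ℕ) (ii jj : ℕ → ℕ) (ss : ℕ → ℤ) : ℕ → Alg P
  | 0 => 1
  | m + 1 => alphaChain P l ii jj ss m *
      alpha P (ii (m + 1)) (jj (m + 1)) (l + 1 - 2 * (m + 1)) (ss (m + 1))

/-- `α_{i₁,j₁,l-2}^{s₁} ⋯ α_{i_m,j_m,l-2m}^{s_m}`. -/
def alphaChainBar (P : Params R) (l : ℕ) (ii jj : ℕ → ℕ) (ss : ℕ → ℤ) : ℕ → Alg P
  | 0 => 1
  | m + 1 => alphaChainBar P l ii jj ss m *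
      alpha P (ii (m + 1)) (jj (m + 1)) (l - 2 * (m + 1)) (ss (m + 1))

/-- `E_{l,m} = e_{l-1} e_{l-3} ⋯ e_{l-2m+1}`. -/
def Echain (P : Params R) (l : ℕ) : ℕ → Alg P
  | 0 => 1
  | m + 1 => Echain P l m * Eg P (l + 1 - 2 * (m + 1))

/-- The set `V_{l,m}^g`. -/
def Vg (P : Params R) (l m : ℕ) : Set (Alg P) :=
  {x | ∃ ii jj : ℕ → ℕ, ∃ ss : ℕ → ℤ,
    (∀ t, 1 ≤ t → t ≤ m →
      1 ≤ ii t ∧ ii t ≤ jj t ∧ jj t ≤ l + 1 - 2 * t ∧ ss t ∈ Pset P.k) ∧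
    x = alphaChain P l ii jj ss m}

/-- The set `V_{l,m}`. -/
def V (P : Params R) (l m : ℕ) : Set (Alg P) :=
  {x | ∃ ii jj : ℕ → ℕ, ∃ ss : ℕ → ℤ,
    (∀ t, 1 ≤ t → t ≤ m →
      1 ≤ ii t ∧ ii t ≤ jj t ∧ jj t ≤ l + 1 - 2 * t ∧ ss t ∈ Pset P.k) ∧
    (∀ t, 1 ≤ t → t + 1 ≤ m → ii (t + 1) < ii t) ∧
    x = alphaChain P l ii jj ss m}

/-- The set `V̄_{l,m}`. -/
def Vbar (P : Params R) (l m : ℕ) : Set (Alg P) :=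
  {x | ∃ ii jj : ℕ → ℕ, ∃ ss : ℕ → ℤ,
    (∀ t, 1 ≤ t → t ≤ m →
      1 ≤ ii t ∧ ii t ≤ jj t ∧ jj t ≤ l + 1 - 2 * t ∧ ss t ∈ Pset P.k) ∧
    (∀ t, 1 ≤ t → t + 1 ≤ m → ii (t + 1) < ii t) ∧
    x = alphaChainBar P l ii jj ss m}

end CBMW

open CBMW

namespace CBMW

section Basic

variable {R : Type} [CommRing R] (P : Params R)

theorem pr_rel {a b : F R} (h : Rel P a b) : pr P a = pr P b :=
  RingQuot.mkAlgHom_rel R h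

theorem Xg_mul_Xgi (i : ℕ) : Xg P i * Xgi P i = 1 := by
  by_cases h : 1 ≤ i ∧ i ≤ P.n - 1
  · simpa [Xg, Xgi] using pr_rel P (Rel.X_inv_right h.1 h.2)
  · have h' : i = 0 ∨ P.n - 1 < i := by omega
    have h1 := pr_rel P (Rel.X_invalid h')
    have h2 := pr_rel P (Rel.Xi_invalid h')
    simp [Xg, Xgi, h1, h2]

theorem Xgi_mul_Xg (i : ℕ) : Xgi P i * Xg P i = 1 := by
  by_cases h : 1 ≤ i ∧ i ≤ P.n - 1
  · simpa [Xg, Xgi] using pr_rel P (Rel.X_inv_left h.1 h.2)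
  · have h' : i = 0 ∨ P.n - 1 < i := by omega
    have h1 := pr_rel P (Rel.X_invalid h')
    have h2 := pr_rel P (Rel.Xi_invalid h')
    simp [Xg, Xgi, h1, h2]

theorem Yg_mul_Ygi : Yg P * Ygi P = 1 := by
  simpa [Yg, Ygi] using pr_rel P Rel.Y_inv_right

theorem Ygi_mul_Yg : Ygi P * Yg P = 1 := by
  simpa [Yg, Ygi] using pr_rel P Rel.Y_inv_left

theorem Eg_zero : Eg P 0 = 0 := by
  simpa [Eg] using pr_rel P (Rel.E_invalid (Or.inl rfl))

variable {P}

theorem Xgi_eq {i : ℕ} (h1 : 1 ≤ i) (h2 : i ≤ P.n - 1) :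
    Xgi P i = Xg P i - P.delta • (1 - Eg P i) := by
  have h := pr_rel P (Rel.skein h1 h2)
  simp only [map_sub, map_smul, map_one] at h
  simp only [Xg, Xgi, Eg, ← h]
  abel

theorem Xg_comm_Xg {i j : ℕ} (h1 : 1 ≤ i) (h : i + 2 ≤ j) (h4 : j ≤ P.n - 1) :
    Commute (Xg P i) (Xg P j) := by
  simpa [Commute, SemiconjBy, Xg] using pr_rel P (Rel.XX_far h1 (by omega) (by omega) h4 (Or.inl h))

theorem Xg_comm_Eg {i j : ℕ} (h1 : 1 ≤ i) (h2 : i ≤ P.n - 1) (h3 : 1 ≤ j) (h4 : j ≤ P.n - 1)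
    (h : i + 2 ≤ j ∨ j + 2 ≤ i) : Commute (Xg P i) (Eg P j) := by
  simpa [Commute, SemiconjBy, Xg, Eg] using pr_rel P (Rel.XE_far h1 h2 h3 h4 h)

theorem Eg_comm_Eg {i j : ℕ} (h1 : 1 ≤ i) (h : i + 2 ≤ j) (h4 : j ≤ P.n - 1) :
    Commute (Eg P i) (Eg P j) := by
  simpa [Commute, SemiconjBy, Eg] using pr_rel P (Rel.EE_far h1 (by omega) (by omega) h4 (Or.inl h))

theorem Yg_comm_Xg {i : ℕ} (h1 : 2 ≤ i) (h2 : i ≤ P.n - 1) : Commute (Yg P) (Xg P i) := by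
  simpa [Commute, SemiconjBy, Yg, Xg] using pr_rel P (Rel.YX_comm h1 h2)

theorem Yg_comm_Eg {i : ℕ} (h1 : 2 ≤ i) (h2 : i ≤ P.n - 1) : Commute (Yg P) (Eg P i) := by
  simpa [Commute, SemiconjBy, Yg, Eg] using pr_rel P (Rel.YE_comm h1 h2)

theorem braid {i : ℕ} (h1 : 1 ≤ i) (h2 : i + 1 ≤ P.n - 1) :
    Xg P i * Xg P (i + 1) * Xg P i = Xg P (i + 1) * Xg P i * Xg P (i + 1) := by
  simpa [Xg] using pr_rel P (Rel.braid h1 h2)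

theorem Xg_mul_Eg {i : ℕ} (h1 : 1 ≤ i) (h2 : i ≤ P.n - 1) :
    Xg P i * Eg P i = (P.lam : R) • Eg P i := by
  simpa [Xg, Eg] using pr_rel P (Rel.untwist_right h1 h2)

theorem Eg_mul_Xg {i : ℕ} (h1 : 1 ≤ i) (h2 : i ≤ P.n - 1) :
    Eg P i * Xg P i = (P.lam : R) • Eg P i := by
  simpa [Xg, Eg] using pr_rel P (Rel.untwist_left h1 h2)

theorem XXE_up {i : ℕ} (h1 : 1 ≤ i) (h2 : i + 1 ≤ P.n - 1) :
    Xg P i * Xg P (i + 1) * Eg P i = Eg P (i + 1) * Eg P i := by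
  simpa [Xg, Eg] using pr_rel P (Rel.XXE h1 (by omega) (by omega) h2 (Or.inl rfl))

theorem XXE_down {i : ℕ} (h1 : 1 ≤ i) (h2 : i + 1 ≤ P.n - 1) :
    Xg P (i + 1) * Xg P i * Eg P (i + 1) = Eg P i * Eg P (i + 1) := by
  simpa [Xg, Eg] using
    pr_rel P (Rel.XXE (i := i + 1) (j := i) (by omega) h2 h1 (by omega) (Or.inr rfl))

theorem EXX_up {i : ℕ} (h1 : 1 ≤ i) (h2 : i + 1 ≤ P.n - 1) :
    Eg P (i + 1) * Xg P i * Xg P (i + 1) = Eg P (i + 1) * Eg P i := by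
  simpa [Xg, Eg] using (pr_rel P (Rel.EXX h1 (by omega) (by omega) h2 (Or.inl rfl))).symm

theorem EXX_down {i : ℕ} (h1 : 1 ≤ i) (h2 : i + 1 ≤ P.n - 1) :
    Eg P i * Xg P (i + 1) * Xg P i = Eg P i * Eg P (i + 1) := by
  simpa [Xg, Eg] using
    (pr_rel P (Rel.EXX (i := i + 1) (j := i) (by omega) h2 h1 (by omega) (Or.inr rfl))).symm

theorem EEE_down {i : ℕ} (h1 : 1 ≤ i) (h2 : i + 1 ≤ P.n - 1) :
    Eg P (i + 1) * Eg P i * Eg P (i + 1) = Eg P (i + 1) := by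
  simpa [Eg] using pr_rel P (Rel.EEE_down h1 h2)

theorem Yg_pow_k : Yg P ^ P.k = ∑ i ∈ Finset.range P.k, P.qc i • Yg P ^ i := by
  simpa [Yg] using pr_rel P (Rel.cyclo)

theorem braidB (h : 1 ≤ P.n - 1) :
    Xg P 1 * Yg P * Xg P 1 * Yg P = Yg P * Xg P 1 * Yg P * Xg P 1 := by
  simpa [Yg, Xg] using pr_rel P (Rel.braidB (by omega))

theorem YXYE (h : 1 ≤ P.n - 1) :
    Yg P * Xg P 1 * Yg P * Eg P 1 = P.laminv • Eg P 1 := by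
  simpa [Yg, Xg, Eg] using pr_rel P (Rel.YXYE (by omega))

theorem EYXY (h : 1 ≤ P.n - 1) :
    Eg P 1 * (Yg P * Xg P 1 * Yg P) = P.laminv • Eg P 1 := by
  simpa [Yg, Xg, Eg] using pr_rel P (Rel.EYXY (by omega))

theorem EYE (h : 1 ≤ P.n - 1) {m : ℕ} (hm : m ≤ P.k - 1) :
    Eg P 1 * Yg P ^ m * Eg P 1 = P.A m • Eg P 1 := by
  simpa [Yg, Eg] using pr_rel P (Rel.EYE (by omega) hm)

/-! ### Consequences of the relations for neighbouring indices -/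

theorem EXX_slide {i : ℕ} (h1 : 1 ≤ i) (h2 : i + 1 ≤ P.n - 1) :
    Eg P (i + 1) * Xg P i * Xg P (i + 1) = Xg P i * Xg P (i + 1) * Eg P i := by
  rw [EXX_up h1 h2, XXE_up h1 h2]

theorem EXX_slide' {i : ℕ} (h1 : 1 ≤ i) (h2 : i + 1 ≤ P.n - 1) :
    Eg P i * Xg P (i + 1) * Xg P i = Xg P (i + 1) * Xg P i * Eg P (i + 1) := by
  rw [EXX_down h1 h2, XXE_down h1 h2]

theorem Eg_mul_Xgi {i : ℕ} (h1 : 1 ≤ i) (h2 : i ≤ P.n - 1) :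
    Eg P i * Xgi P i = P.laminv • Eg P i := by
  have h : (P.lam : R) • (Eg P i * Xgi P i) = Eg P i := by
    rw [← smul_mul_assoc, ← Eg_mul_Xg h1 h2, mul_assoc, Xg_mul_Xgi, mul_one]
  conv_rhs => rw [← h, smul_smul]
  simp [Params.laminv]

theorem Xgi_mul_Eg_succ {i : ℕ} (h1 : 1 ≤ i) (h2 : i + 1 ≤ P.n - 1) :
    Xgi P i * Eg P (i + 1) = Xg P (i + 1) * Eg P i * Eg P (i + 1) := by
  conv_lhs => rw [← EEE_down h1 h2, ← XXE_up h1 h2]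
  simp only [← mul_assoc, Xgi_mul_Xg, one_mul]

theorem Xg_mul_Eg_succ {i : ℕ} (h1 : 1 ≤ i) (h2 : i + 1 ≤ P.n - 1) :
    Xg P i * Eg P (i + 1) = Xgi P (i + 1) * Eg P i * Eg P (i + 1) := by
  rw [mul_assoc, ← XXE_down h1 h2]
  simp only [← mul_assoc, Xgi_mul_Xg, one_mul]

theorem Eg_succ_mul_Xg {i : ℕ} (h1 : 1 ≤ i) (h2 : i + 1 ≤ P.n - 1) :
    Eg P (i + 1) * Xg P i = Eg P (i + 1) * Eg P i * Xgi P (i + 1) := by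
  rw [← EXX_up h1 h2]
  simp only [mul_assoc, Xg_mul_Xgi, mul_one]

theorem Eg_mul_Xg_succ {i : ℕ} (h1 : 1 ≤ i) (h2 : i + 1 ≤ P.n - 1) :
    Eg P i * Xg P (i + 1) = Eg P i * Eg P (i + 1) * Xgi P i := by
  rw [← EXX_down h1 h2]
  simp only [mul_assoc, Xg_mul_Xgi, mul_one]

theorem Eg_succ_mul_Xgi {i : ℕ} (h1 : 1 ≤ i) (h2 : i + 1 ≤ P.n - 1) :
    Eg P (i + 1) * Xgi P i = Eg P (i + 1) * Eg P i * Xg P (i + 1) := by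
  conv_lhs => rw [← EEE_down h1 h2, mul_assoc, mul_assoc, ← mul_assoc (Eg P i), ← EXX_down h1 h2]
  simp only [mul_assoc, Xg_mul_Xgi, mul_one]

theorem Eg_Xg_Eg {i : ℕ} (h1 : 1 ≤ i) (h2 : i + 1 ≤ P.n - 1) :
    Eg P (i + 1) * Xg P i * Eg P (i + 1) = P.laminv • Eg P (i + 1) := by
  rw [mul_assoc, Xg_mul_Eg_succ h1 h2, mul_assoc, ← mul_assoc, Eg_mul_Xgi (by omega) h2,
    smul_mul_assoc, ← mul_assoc, EEE_down h1 h2]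

/-! ### The elements `Yᵢ'` as units -/

theorem downX_mul_upXi (m : ℕ) : downX P m * upXi P m = 1 := by
  induction m with
  | zero => simp [downX, upXi]
  | succ m ih =>
    rw [downX, upXi, mul_assoc, ← mul_assoc (downX P m), ih, one_mul, Xg_mul_Xgi]

theorem upXi_mul_downX (m : ℕ) : upXi P m * downX P m = 1 := by
  induction m with
  | zero => simp [downX, upXi]
  | succ m ih =>
    rw [downX, upXi, mul_assoc, ← mul_assoc (Xgi P _), Xgi_mul_Xg, one_mul, ih]

theorem upX_mul_downXi (m : ℕ) : upX P m * downXi P m = 1 := by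
  induction m with
  | zero => simp [upX, downXi]
  | succ m ih =>
    rw [upX, downXi, mul_assoc, ← mul_assoc (Xg P _), Xg_mul_Xgi, one_mul, ih]

theorem downXi_mul_upX (m : ℕ) : downXi P m * upX P m = 1 := by
  induction m with
  | zero => simp [upX, downXi]
  | succ m ih =>
    rw [upX, downXi, mul_assoc, ← mul_assoc (downXi P m), ih, one_mul, Xgi_mul_Xg]

variable (P) in
/-- `Yᵢ'` as a unit. -/
def Yu (i : ℕ) : (Alg P)ˣ where
  val := Yp P i
  inv := YpInv P i
  val_inv := by
    rw [Yp, YpInv]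
    calc _ = downX P (i - 1) * (Yg P * ((upX P (i - 1) * downXi P (i - 1)) * Ygi P)) *
          upXi P (i - 1) := by simp only [mul_assoc]
      _ = 1 := by rw [upX_mul_downXi, one_mul, Yg_mul_Ygi, mul_one, downX_mul_upXi]
  inv_val := by
    rw [Yp, YpInv]
    calc _ = downXi P (i - 1) * (Ygi P * ((upXi P (i - 1) * downX P (i - 1)) * Yg P)) *
          upX P (i - 1) := by simp only [mul_assoc]
      _ = 1 := by rw [upXi_mul_downX, one_mul, Ygi_mul_Yg, mul_one, downXi_mul_upX]

theorem Ypow_eq (i : ℕ) (p : ℤ) : Ypow P i p = ((Yu P i ^ p : (Alg P)ˣ) : Alg P) := by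
  unfold Ypow
  split_ifs with h
  · obtain ⟨m, rfl⟩ := Int.eq_ofNat_of_zero_le h
    simp [Yu]
  · obtain ⟨m, hm⟩ := Int.eq_ofNat_of_zero_le (show 0 ≤ -p by omega)
    obtain rfl : p = -m := by omega
    simp [Yu, ← inv_pow]

theorem Yu_one : (Yu P 1 : Alg P) = Yg P := by
  simp [Yu, Yp, downX, upX]

theorem Yu_one_inv : ((Yu P 1)⁻¹ : (Alg P)ˣ) = Ygi P := by
  simp [Yu, YpInv, downXi, upXi]

theorem Yu_succ {i : ℕ} (h1 : 1 ≤ i) :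
    (Yu P (i + 1) : Alg P) = Xg P i * Yu P i * Xg P i := by
  obtain ⟨j, rfl⟩ := Nat.exists_eq_add_of_le' h1
  simp [Yu, Yp, downX, upX, mul_assoc]

theorem Yu_succ_inv {i : ℕ} (h1 : 1 ≤ i) :
    (((Yu P (i + 1))⁻¹ : (Alg P)ˣ) : Alg P) = Xgi P i * ((Yu P i)⁻¹ : (Alg P)ˣ) * Xgi P i := by
  obtain ⟨j, rfl⟩ := Nat.exists_eq_add_of_le' h1
  simp [Yu, YpInv, downXi, upXi, mul_assoc]

end Basic

end CBMW

namespace CBMW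

section Commutation

variable {R : Type} [CommRing R] {P : Params R}

theorem Ypow_zero (i : ℕ) : Ypow P i 0 = 1 := by simp [Ypow_eq]

theorem Ypow_add (i : ℕ) (p q : ℤ) : Ypow P i (p + q) = Ypow P i p * Ypow P i q := by
  simp [Ypow_eq, zpow_add]

theorem Ypow_one (i : ℕ) : Ypow P i 1 = Yp P i := by simp [Ypow, Int.toNat_one]

theorem Ypow_neg_one (i : ℕ) : Ypow P i (-1) = YpInv P i := by simp [Ypow]

theorem Ypow_one_one : Ypow P 1 1 = Yg P := by simpa [Ypow_eq] using Yu_one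

theorem Ypow_one_neg_one : Ypow P 1 (-1) = Ygi P := by simpa [Ypow_eq] using Yu_one_inv

theorem Ypow_one_natCast (m : ℕ) : Ypow P 1 m = Yg P ^ m := by
  simp [Ypow_eq, Yu_one]

theorem Ypow_mul_neg (i : ℕ) (p : ℤ) : Ypow P i p * Ypow P i (-p) = 1 := by
  rw [← Ypow_add, add_neg_cancel, Ypow_zero]

theorem Ypow_neg_mul (i : ℕ) (p : ℤ) : Ypow P i (-p) * Ypow P i p = 1 := by
  rw [← Ypow_add, neg_add_cancel, Ypow_zero]

theorem Yp_succ {i : ℕ} (h1 : 1 ≤ i) : Yp P (i + 1) = Xg P i * Yp P i * Xg P i :=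
  Yu_succ h1

theorem YpInv_succ {i : ℕ} (h1 : 1 ≤ i) : YpInv P (i + 1) = Xgi P i * YpInv P i * Xgi P i :=
  Yu_succ_inv h1

theorem Commute.Ypow_right {c : Alg P} {i : ℕ} (h : Commute c (Yp P i)) (p : ℤ) :
    Commute c (Ypow P i p) := by
  rw [Ypow_eq]
  exact Commute.units_zpow_right (u := Yu P i) h p

theorem Commute.Xgi_right {c : Alg P} {i : ℕ} (h : Commute c (Xg P i)) : Commute c (Xgi P i) :=
  Commute.units_inv_right (u := ⟨Xg P i, Xgi P i, Xg_mul_Xgi P i, Xgi_mul_Xg P i⟩) h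

theorem Commute.Ygi_right {c : Alg P} (h : Commute c (Yg P)) : Commute c (Ygi P) :=
  Commute.units_inv_right (u := ⟨Yg P, Ygi P, Yg_mul_Ygi P, Ygi_mul_Yg P⟩) h

variable (P) in
/-- The generators of `Bc P m`. -/
def BcGen (m : ℕ) : Set (Alg P) :=
  {x | (1 ≤ m ∧ (x = Yg P ∨ x = Ygi P)) ∨
    ∃ i, 1 ≤ i ∧ i + 1 ≤ m ∧ (x = Xg P i ∨ x = Xgi P i ∨ x = Eg P i)}

variable (P) in
/-- The subalgebra on the first `m` strands; it differs from `Bsub P m` only in that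
`Bc P 0` consists of scalars. -/
def Bc (m : ℕ) : Subalgebra R (Alg P) := Algebra.adjoin R (BcGen P m)

theorem Bc_le_Bsub (m : ℕ) : Bc P m ≤ Bsub P m := by
  apply Algebra.adjoin_mono
  rintro x (⟨-, hx⟩ | hx)
  · exact Or.inl hx
  · exact Or.inr hx

theorem Bsub_le_Bc {m : ℕ} (hm : 1 ≤ m) : Bsub P m ≤ Bc P m := by
  apply Algebra.adjoin_mono
  rintro x (hx | hx)
  · exact Or.inl ⟨hm, hx⟩
  · exact Or.inr hx

theorem Bc_mono {m m' : ℕ} (h : m ≤ m') : Bc P m ≤ Bc P m' := by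
  apply Algebra.adjoin_mono
  rintro x (⟨h1, hx⟩ | ⟨i, h1, h2, hx⟩)
  · exact Or.inl ⟨by omega, hx⟩
  · exact Or.inr ⟨i, h1, by omega, hx⟩

theorem Yg_mem {m : ℕ} (h : 1 ≤ m) : Yg P ∈ Bc P m :=
  Algebra.subset_adjoin (Or.inl ⟨h, Or.inl rfl⟩)

theorem Ygi_mem {m : ℕ} (h : 1 ≤ m) : Ygi P ∈ Bc P m :=
  Algebra.subset_adjoin (Or.inl ⟨h, Or.inr rfl⟩)

theorem Xg_mem {i m : ℕ} (h1 : 1 ≤ i) (h : i + 1 ≤ m) : Xg P i ∈ Bc P m :=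
  Algebra.subset_adjoin (Or.inr ⟨i, h1, h, Or.inl rfl⟩)

theorem Xgi_mem {i m : ℕ} (h1 : 1 ≤ i) (h : i + 1 ≤ m) : Xgi P i ∈ Bc P m :=
  Algebra.subset_adjoin (Or.inr ⟨i, h1, h, Or.inr (Or.inl rfl)⟩)

theorem Eg_mem {i m : ℕ} (h1 : 1 ≤ i) (h : i + 1 ≤ m) : Eg P i ∈ Bc P m :=
  Algebra.subset_adjoin (Or.inr ⟨i, h1, h, Or.inr (Or.inr rfl)⟩)

theorem Yp_mem {i : ℕ} (h1 : 1 ≤ i) : Yp P i ∈ Bc P i ∧ YpInv P i ∈ Bc P i := by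
  induction i, h1 using Nat.le_induction with
  | base =>
    rw [← Ypow_one, ← Ypow_neg_one, Ypow_one_one, Ypow_one_neg_one]
    exact ⟨Yg_mem le_rfl, Ygi_mem le_rfl⟩
  | succ i h1 ih =>
    have hle := Bc_mono (P := P) (Nat.le_succ i)
    rw [Yp_succ h1, YpInv_succ h1]
    exact ⟨mul_mem (mul_mem (Xg_mem h1 le_rfl) (hle ih.1)) (Xg_mem h1 le_rfl),
      mul_mem (mul_mem (Xgi_mem h1 le_rfl) (hle ih.2)) (Xgi_mem h1 le_rfl)⟩

theorem Ypow_mem {i m : ℕ} (h1 : 1 ≤ i) (h : i ≤ m) (p : ℤ) : Ypow P i p ∈ Bc P m := by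
  apply Bc_mono h
  unfold Ypow
  split_ifs
  · exact pow_mem (Yp_mem h1).1 _
  · exact pow_mem (Yp_mem h1).2 _

/-- An element commuting with the generators commutes with `Bc P m`. -/
theorem commute_Bc {c x : Alg P} {m : ℕ} (hx : x ∈ Bc P m)
    (hY : 1 ≤ m → Commute c (Yg P))
    (hX : ∀ i, 1 ≤ i → i + 1 ≤ m → Commute c (Xg P i))
    (hE : ∀ i, 1 ≤ i → i + 1 ≤ m → Commute c (Eg P i)) : Commute c x := by
  refine Algebra.commute_of_mem_adjoin_of_forall_mem_commute hx ?_
  rintro b (⟨h1, rfl | rfl⟩ | ⟨i, h1, h2, rfl | rfl | rfl⟩)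
  · exact hY h1
  · exact (hY h1).Ygi_right
  · exact hX i h1 h2
  · exact (hX i h1 h2).Xgi_right
  · exact hE i h1 h2

theorem Xg_comm_Bc {x : Alg P} {m j : ℕ} (hx : x ∈ Bc P m) (hj : m + 1 ≤ j) (hn : j ≤ P.n - 1) :
    Commute (Xg P j) x :=
  commute_Bc hx (fun h => (Yg_comm_Xg (by omega) hn).symm)
    (fun i h1 h2 => (Xg_comm_Xg h1 (by omega) hn).symm)
    (fun i h1 h2 => Xg_comm_Eg (by omega) hn h1 (by omega) (Or.inr (by omega)))

theorem Eg_comm_Bc {x : Alg P} {m j : ℕ} (hx : x ∈ Bc P m) (hj : m + 1 ≤ j) (hn : j ≤ P.n - 1) :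
    Commute (Eg P j) x :=
  commute_Bc hx (fun h => (Yg_comm_Eg (by omega) hn).symm)
    (fun i h1 h2 => (Xg_comm_Eg h1 (by omega) (by omega) hn (Or.inl (by omega))).symm)
    (fun i h1 h2 => (Eg_comm_Eg h1 (by omega) hn).symm)

theorem Yp_succ_comm_Bc {x : Alg P} {i : ℕ} (h1 : 1 ≤ i) (hn : i ≤ P.n - 1) (hx : x ∈ Bc P i) :
    Commute (Yp P (i + 1)) x := by
  induction i, h1 using Nat.le_induction generalizing x with
  | base =>
    refine commute_Bc hx (fun _ => ?_) (fun i h1 h2 => by omega) (fun i h1 h2 => by omega)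
    rw [Yp_succ le_rfl, ← Ypow_one, Ypow_one_one]
    simpa [Commute, SemiconjBy, mul_assoc] using braidB hn
  | succ i h1 ih =>
    have hXY : Commute (Xg P (i + 1)) (Yp P i) :=
      Xg_comm_Bc (Yp_mem h1).1 le_rfl hn
    have hbr := braid h1 hn
    have hsl := EXX_slide' h1 hn
    have far {c : Alg P} (hc : c ∈ Bc P i) (h : Commute (Xg P (i + 1)) c) :
        Commute (Yp P (i + 1 + 1)) c := by
      rw [Yp_succ (by omega)]
      exact (h.mul_left (ih (by omega) hc)).mul_left h
    have hE' : Eg P (i + 1) * Xg P i * Xg P (i + 1) = Xg P i * Xg P (i + 1) * Eg P i :=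
      EXX_slide h1 hn
    have hy : Yp P (i + 1 + 1) =
        Xg P (i + 1) * Xg P i * Yp P i * (Xg P i * Xg P (i + 1)) := by
      rw [Yp_succ (by omega), Yp_succ h1]
      simp only [mul_assoc]
    refine commute_Bc hx (fun _ => far (Yg_mem h1) (Yg_comm_Xg (by omega) hn).symm) ?_ ?_
    · intro t ht1 ht2
      rcases (show t + 1 ≤ i ∨ t = i by omega) with h | rfl
      · exact far (Xg_mem ht1 h) (Xg_comm_Xg ht1 (by omega) hn).symm
      · rw [hy]
        have hXY := hXY.eq
        simp only [Commute, SemiconjBy]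
        linear_combination (norm := noncomm_ring)
          Xg P (t + 1) * Xg P t * Yp P t * hbr - hbr * Yp P t * Xg P t * Xg P (t + 1)
            - Xg P (t + 1) * Xg P t * hXY * Xg P t * Xg P (t + 1)
    · intro t ht1 ht2
      rcases (show t + 1 ≤ i ∨ t = i by omega) with h | rfl
      · exact far (Eg_mem ht1 h)
          (Xg_comm_Eg (by omega) hn ht1 (by omega) (Or.inr (by omega)))
      · rw [hy]
        have hEY := (Eg_comm_Bc (Yp_mem ht1).1 le_rfl hn).eq
        simp only [Commute, SemiconjBy]
        linear_combination (norm := noncomm_ring)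
          -(Xg P (t + 1) * Xg P t * Yp P t * hE') - hsl * Yp P t * Xg P t * Xg P (t + 1)
            - Xg P (t + 1) * Xg P t * hEY * Xg P t * Xg P (t + 1)

theorem Ypow_succ_comm_Bc {x : Alg P} {i : ℕ} (h1 : 1 ≤ i) (hn : i ≤ P.n - 1) (hx : x ∈ Bc P i)
    (p : ℤ) : Commute x (Ypow P (i + 1) p) :=
  (Yp_succ_comm_Bc h1 hn hx).symm.Ypow_right p

theorem Ypow_comm_Bc {x : Alg P} {i : ℕ} (h1 : 1 ≤ i) (hn : i ≤ P.n) (hx : x ∈ Bc P (i - 1))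
    (p : ℤ) : Commute x (Ypow P i p) := by
  rcases (show i = 1 ∨ 2 ≤ i by omega) with rfl | h
  · exact (commute_Bc hx (fun h => by simp at h) (fun j _ h => by omega)
      (fun j _ h => by omega)).symm
  · obtain ⟨j, rfl⟩ := Nat.exists_eq_add_of_le' h1
    exact Ypow_succ_comm_Bc (by omega) (by omega) hx p

/-! ### Interaction of `Yᵢ'`, `Yᵢ₊₁'`, `Xᵢ` and `eᵢ` -/

theorem Yp_Xg_Yp_Eg {i : ℕ} (h1 : 1 ≤ i) (hn : i ≤ P.n - 1) :
    Yp P i * Xg P i * Yp P i * Eg P i = P.laminv • Eg P i ∧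
      Eg P i * Yp P i * Xg P i * Yp P i = P.laminv • Eg P i := by
  induction i, h1 using Nat.le_induction with
  | base =>
    have h : Yp P 1 = Yg P := by rw [← Ypow_one, Ypow_one_one]
    rw [h]
    exact ⟨YXYE hn, by simpa only [mul_assoc] using EYXY hn⟩
  | succ i h1 ih =>
    obtain ⟨ih1, ih2⟩ := ih (by omega)
    have hXY := (Xg_comm_Bc (Yp_mem h1).1 le_rfl hn).eq
    have hbr := braid h1 hn
    have hy := Yp_succ (P := P) h1
    constructor
    · have e1 := XXE_down h1 hn
      have e2 := XXE_up h1 hn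
      have e3 := EEE_down h1 hn
      calc _ = Xg P i * Yp P i * (Xg P i * Xg P (i + 1) * Xg P i) * Yp P i * Xg P i *
            Eg P (i + 1) := by rw [hy]; noncomm_ring
        _ = Xg P i * (Yp P i * Xg P (i + 1)) * Xg P i * (Xg P (i + 1) * Yp P i) * Xg P i *
            Eg P (i + 1) := by rw [hbr]; noncomm_ring
        _ = Xg P i * Xg P (i + 1) * Yp P i * Xg P i * Yp P i *
            (Xg P (i + 1) * Xg P i * Eg P (i + 1)) := by
          linear_combination (norm := noncomm_ring)
            Xg P i * Xg P (i + 1) * Yp P i * Xg P i * hXY * Xg P i * Eg P (i + 1) -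
              Xg P i * hXY * Xg P i * Xg P (i + 1) * Yp P i * Xg P i * Eg P (i + 1)
        _ = Xg P i * Xg P (i + 1) * (Yp P i * Xg P i * Yp P i * Eg P i) * Eg P (i + 1) := by
          rw [e1]; noncomm_ring
        _ = P.laminv • (Xg P i * Xg P (i + 1) * Eg P i * Eg P (i + 1)) := by
          rw [ih1]; simp only [mul_smul_comm, smul_mul_assoc]
        _ = _ := by rw [e2, e3]
    · have e1 := EXX_up h1 hn
      have e2 := EXX_down h1 hn
      have e3 := EEE_down h1 hn
      calc _ = Eg P (i + 1) * Xg P i * Yp P i * (Xg P i * Xg P (i + 1) * Xg P i) * Yp P i *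
            Xg P i := by rw [hy]; noncomm_ring
        _ = Eg P (i + 1) * Xg P i * (Yp P i * Xg P (i + 1)) * Xg P i *
            (Xg P (i + 1) * Yp P i) * Xg P i := by rw [hbr]; noncomm_ring
        _ = Eg P (i + 1) * Xg P i * Xg P (i + 1) * Yp P i * Xg P i * Yp P i *
            (Xg P (i + 1) * Xg P i) := by
          linear_combination (norm := noncomm_ring)
            Eg P (i + 1) * Xg P i * Xg P (i + 1) * Yp P i * Xg P i * hXY * Xg P i -
              Eg P (i + 1) * Xg P i * hXY * Xg P i * Xg P (i + 1) * Yp P i * Xg P i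
        _ = Eg P (i + 1) * (Eg P i * Yp P i * Xg P i * Yp P i) *
            (Xg P (i + 1) * Xg P i) := by
          rw [e1]; noncomm_ring
        _ = P.laminv • (Eg P (i + 1) * (Eg P i * Xg P (i + 1) * Xg P i)) := by
          rw [ih2]; simp only [mul_smul_comm, smul_mul_assoc, mul_assoc]
        _ = _ := by rw [e2, ← mul_assoc, e3]

theorem lam_smul_laminv (x : Alg P) : (P.lam : R) • P.laminv • x = x := by
  simp [smul_smul, Params.laminv]

theorem Ypow_succ_mul_Eg {i : ℕ} (h1 : 1 ≤ i) (hn : i ≤ P.n - 1) (p : ℤ) :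
    Ypow P (i + 1) p * Eg P i = Ypow P i (-p) * Eg P i := by
  have hc : Commute (Yu P i) (Yu P (i + 1)) :=
    Units.ext (Yp_succ_comm_Bc h1 hn (Yp_mem h1).1).symm.eq
  have h : ((Yu P i * Yu P (i + 1) : (Alg P)ˣ) : Alg P) * Eg P i = Eg P i := by
    change Yp P i * Yp P (i + 1) * Eg P i = _
    rw [Yp_succ h1, ← mul_assoc, mul_assoc _ (Xg P i) (Eg P i), Xg_mul_Eg h1 hn, mul_smul_comm,
      ← mul_assoc, (Yp_Xg_Yp_Eg h1 hn).1, lam_smul_laminv]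
  have hp : ∀ p : ℤ, (((Yu P i * Yu P (i + 1)) ^ p : (Alg P)ˣ) : Alg P) * Eg P i = Eg P i := by
    intro p
    induction p with
    | zero => simp
    | succ m ih => rw [zpow_add_one, Units.val_mul, mul_assoc, h, ih]
    | pred m ih =>
      rw [zpow_sub_one, Units.val_mul, mul_assoc]
      conv_lhs => rw [← h, ← mul_assoc, ← mul_assoc, Units.inv_mul_cancel_right]
      rw [ih]
  have := hp p
  rw [hc.mul_zpow, Units.val_mul, ← Ypow_eq, ← Ypow_eq, mul_assoc] at this
  conv_rhs => rw [← this, ← mul_assoc, Ypow_neg_mul, one_mul]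

theorem Eg_mul_Ypow_succ {i : ℕ} (h1 : 1 ≤ i) (hn : i ≤ P.n - 1) (p : ℤ) :
    Eg P i * Ypow P (i + 1) p = Eg P i * Ypow P i (-p) := by
  have hc : Commute (Yu P (i + 1)) (Yu P i) :=
    Units.ext (Yp_succ_comm_Bc h1 hn (Yp_mem h1).1).eq
  have h : Eg P i * ((Yu P (i + 1) * Yu P i : (Alg P)ˣ) : Alg P) = Eg P i := by
    change Eg P i * (Yp P (i + 1) * Yp P i) = _
    rw [Yp_succ h1, ← mul_assoc, ← mul_assoc, ← mul_assoc, Eg_mul_Xg h1 hn, smul_mul_assoc,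
      smul_mul_assoc, smul_mul_assoc, (Yp_Xg_Yp_Eg h1 hn).2, lam_smul_laminv]
  have hp : ∀ p : ℤ, Eg P i * (((Yu P (i + 1) * Yu P i) ^ p : (Alg P)ˣ) : Alg P) = Eg P i := by
    intro p
    induction p with
    | zero => simp
    | succ m ih => rw [zpow_add_one, Units.val_mul, ← mul_assoc, ih, h]
    | pred m ih =>
      rw [zpow_sub_one, Units.val_mul, ← mul_assoc, ih]
      conv_lhs => rw [← h, Units.mul_inv_cancel_right]
  have := hp p
  rw [hc.mul_zpow, Units.val_mul, ← Ypow_eq, ← Ypow_eq, ← mul_assoc] at this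
  conv_rhs => rw [← this, mul_assoc, Ypow_mul_neg, mul_one]

theorem Xg_mul_Ypow_one {i : ℕ} (h1 : 1 ≤ i) :
    Xg P i * Ypow P i 1 = Ypow P (i + 1) 1 * Xgi P i := by
  rw [Ypow_one, Ypow_one, Yp_succ h1, mul_assoc _ _ (Xgi P i), Xg_mul_Xgi, mul_one]

theorem Ypow_one_mul_Xg {i : ℕ} (h1 : 1 ≤ i) :
    Ypow P i 1 * Xg P i = Xgi P i * Ypow P (i + 1) 1 := by
  rw [Ypow_one, Ypow_one, Yp_succ h1, ← mul_assoc, ← mul_assoc, Xgi_mul_Xg, one_mul]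

theorem Ypow_succ_Xg {i : ℕ} (h1 : 1 ≤ i) (hn : i ≤ P.n - 1) (p : ℤ) :
    Ypow P (i + 1) (p + 1) * Xg P i = Ypow P (i + 1) p * Xg P i * Ypow P i 1 +
      P.delta • Ypow P (i + 1) (p + 1) - P.delta • (Ypow P (i + 1) (p + 1) * Eg P i) := by
  rw [mul_assoc, Xg_mul_Ypow_one h1, Xgi_eq h1 hn, Ypow_add]
  simp only [mul_sub, mul_smul_comm, mul_one, smul_sub, mul_assoc]
  abel

theorem Xg_Ypow_succ {i : ℕ} (h1 : 1 ≤ i) (hn : i ≤ P.n - 1) (p : ℤ) :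
    Xg P i * Ypow P (i + 1) (p + 1) = Ypow P i 1 * Xg P i * Ypow P (i + 1) p +
      P.delta • Ypow P (i + 1) (p + 1) - P.delta • (Eg P i * Ypow P (i + 1) (p + 1)) := by
  rw [Ypow_one_mul_Xg h1, Xgi_eq h1 hn, add_comm p, Ypow_add]
  simp only [sub_mul, smul_mul_assoc, one_mul, smul_sub, mul_assoc]
  abel

theorem Ypow_sub_one_Xg {i : ℕ} (h1 : 1 ≤ i) (p : ℤ) :
    Ypow P (i + 1) (p - 1) * Xg P i = Ypow P (i + 1) p * Xgi P i * Ypow P i (-1) := by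
  have h := Xg_mul_Ypow_one (P := P) h1
  rw [show p = p - 1 + 1 by ring, Ypow_add, mul_assoc _ _ (Xgi P i), ← h]
  simp only [mul_assoc, Ypow_mul_neg, mul_one]
  simp

theorem Xg_Ypow_sub_one {i : ℕ} (h1 : 1 ≤ i) (hn : i ≤ P.n - 1) (p : ℤ) :
    Xg P i * Ypow P i (p - 1) = Ypow P (i + 1) (-1) * Xg P i * Ypow P i p +
      P.delta • Ypow P i (p - 1) - P.delta • (Eg P i * Ypow P i (p - 1)) := by
  rw [show (-1 : ℤ) = 0 - 1 by ring, Ypow_sub_one_Xg h1, Ypow_zero, one_mul, Xgi_eq h1 hn,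
    mul_assoc, ← Ypow_add, show -1 + p = p - 1 by ring]
  simp only [sub_mul, smul_mul_assoc, one_mul, smul_sub]
  abel

end Commutation

end CBMW

namespace CBMW

section Decomposition

variable {R : Type} [CommRing R] {P : Params R}

theorem span_mul_right_mem {A : Type*} [Ring A] [Algebra R A] {S : Set A} {N : Submodule R A}
    {c z : A} (h : ∀ s ∈ S, s * c ∈ N) (hz : z ∈ Submodule.span R S) : z * c ∈ N :=
  (Submodule.span_le (p := N.comap (LinearMap.mulRight R c))).2 h hz

theorem span_mul_left_mem {A : Type*} [Ring A] [Algebra R A] {S : Set A} {N : Submodule R A}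
    {c z : A} (h : ∀ s ∈ S, c * s ∈ N) (hz : z ∈ Submodule.span R S) : c * z ∈ N :=
  (Submodule.span_le (p := N.comap (LinearMap.mulLeft R c))).2 h hz

theorem adjoin_mul_mem {A : Type*} [Ring A] [Algebra R A] {S : Set A} {N : Submodule R A}
    (h : ∀ s ∈ S, ∀ z ∈ N, s * z ∈ N) {x z : A} (hx : x ∈ Algebra.adjoin R S) (hz : z ∈ N) :
    x * z ∈ N := by
  induction hx using Algebra.adjoin_induction generalizing z with
  | mem s hs => exact h s hs z hz
  | algebraMap r => rw [← Algebra.smul_def]; exact N.smul_mem r hz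
  | add x y _ _ hx hy => rw [add_mul]; exact N.add_mem (hx hz) (hy hz)
  | mul x y _ _ hx hy => rw [mul_assoc]; exact hx (hy hz)

variable (P) in
/-- `Xᵢ Xᵢ₊₁ ⋯ X_{l-1}`. -/
def gam (i l : ℕ) : Alg P := ((List.range' i (l - i)).map fun t => Xg P t).prod

theorem gam_self (i : ℕ) : gam P i i = 1 := by simp [gam]

theorem gam_cons {i l : ℕ} (h : i < l) : gam P i l = Xg P i * gam P (i + 1) l := by
  have : l - i = (l - (i + 1)) + 1 := by omega
  rw [gam, this, List.range'_succ]
  simp [gam]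

theorem gam_snoc {i l : ℕ} (h : i ≤ l) : gam P i (l + 1) = gam P i l * Xg P l := by
  have : l + 1 - i = (l - i) + 1 := by omega
  rw [gam, this, List.range'_concat]
  simp [gam, show i + (l - i) = l by omega]

theorem gam_mem {i l : ℕ} (h1 : 1 ≤ i) : gam P i l ∈ Bc P l := by
  apply Subalgebra.list_prod_mem
  simp only [List.mem_map, List.mem_range'_1]
  rintro _ ⟨t, ht, rfl⟩
  exact Xg_mem (by omega) (by omega)

theorem commute_gam {c : Alg P} {i l : ℕ} (h : ∀ t, i ≤ t → t < l → Commute c (Xg P t)) :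
    Commute c (gam P i l) := by
  apply Commute.list_prod_right
  simp only [List.mem_map, List.mem_range'_1]
  rintro _ ⟨t, ht, rfl⟩
  exact h t (by omega) (by omega)

theorem Xg_gam {i r l : ℕ} (h1 : 1 ≤ i) (hir : i ≤ r) (hl : r + 2 ≤ l) (hn : l ≤ P.n - 1 + 1) :
    Xg P (r + 1) * gam P i l = gam P i l * Xg P r ∧
      Eg P (r + 1) * gam P i l = gam P i l * Eg P r := by
  induction l, hl using Nat.le_induction with
  | base =>
    have hX : Commute (Xg P (r + 1)) (gam P i r) := Xg_comm_Bc (gam_mem h1) le_rfl (by omega)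
    have hE : Commute (Eg P (r + 1)) (gam P i r) := Eg_comm_Bc (gam_mem h1) le_rfl (by omega)
    have hbr := braid (P := P) (i := r) (by omega) (by omega)
    have hsl := EXX_slide (P := P) (i := r) (by omega) (by omega)
    rw [gam_snoc (by omega), gam_snoc hir, ← mul_assoc, ← mul_assoc, ← mul_assoc, ← mul_assoc,
      hX.eq, hE.eq]
    constructor
    · rw [mul_assoc (gam P i r), mul_assoc (gam P i r), ← hbr]; simp only [mul_assoc]
    · rw [mul_assoc (gam P i r), mul_assoc (gam P i r), hsl]; simp only [mul_assoc]
  | succ l hl ih =>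
    obtain ⟨ihX, ihE⟩ := ih (by omega)
    have hX : Commute (Xg P r) (Xg P l) := Xg_comm_Xg (by omega) hl (by omega)
    have hE : Commute (Xg P l) (Eg P r) :=
      Xg_comm_Eg (by omega) (by omega) (by omega) (by omega) (Or.inr hl)
    rw [gam_snoc (by omega)]
    constructor
    · rw [← mul_assoc, ihX, mul_assoc, hX.eq, mul_assoc]
    · rw [← mul_assoc, ihE, mul_assoc, ← hE.eq, mul_assoc]

theorem Eg_gam {i m : ℕ} (h1 : 1 ≤ i) (him : i ≤ m) (hn : m ≤ P.n - 1) :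
    ∃ x ∈ Bc P (m + 1), ∃ b ∈ Bc P m, Eg P i * gam P (i + 1) (m + 1) = x * Eg P m * b := by
  induction m, him using Nat.le_induction with
  | base => exact ⟨1, one_mem _, 1, one_mem _, by simp [gam_self]⟩
  | succ m him ih =>
    obtain ⟨x, hx, b, hb, h⟩ := ih (by omega)
    refine ⟨x * Eg P m, Bc_mono (by omega) (mul_mem hx (Eg_mem (by omega) le_rfl)),
      Xgi P m * b, mul_mem (Xgi_mem (by omega) le_rfl) (Bc_mono (by omega) hb), ?_⟩
    have hX : Commute (Xg P (m + 1)) b := Xg_comm_Bc hb le_rfl hn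
    have hE := Eg_mul_Xg_succ (P := P) (i := m) (by omega) hn
    calc _ = x * Eg P m * (b * Xg P (m + 1)) := by
          rw [gam_snoc (by omega), ← mul_assoc, h, mul_assoc]
      _ = x * (Eg P m * Xg P (m + 1)) * b := by rw [← hX.eq]; simp only [mul_assoc]
      _ = _ := by rw [hE]; simp only [mul_assoc]

variable (P) in
/-- The span of `B_{m+1} e_m B_m`. -/
def H (m : ℕ) : Submodule R (Alg P) :=
  Submodule.span R {z | ∃ x b : Alg P, x ∈ Bc P (m + 1) ∧ b ∈ Bc P m ∧ z = x * Eg P m * b}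

theorem H_mul_left {m : ℕ} {c z : Alg P} (hc : c ∈ Bc P (m + 1)) (hz : z ∈ H P m) :
    c * z ∈ H P m := by
  refine span_mul_left_mem ?_ hz
  rintro _ ⟨x, b, hx, hb, rfl⟩
  exact Submodule.subset_span ⟨c * x, b, mul_mem hc hx, hb, by simp only [mul_assoc]⟩

theorem H_mul_right {m : ℕ} {c z : Alg P} (hc : c ∈ Bc P m) (hz : z ∈ H P m) :
    z * c ∈ H P m := by
  refine span_mul_right_mem ?_ hz
  rintro _ ⟨x, b, hx, hb, rfl⟩
  exact Submodule.subset_span ⟨x, b * c, hx, mul_mem hb hc, by simp only [mul_assoc]⟩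

theorem Eg_gam_mem_H {i m : ℕ} (h1 : 1 ≤ i) (him : i ≤ m) (hn : m ≤ P.n - 1) :
    Eg P i * gam P (i + 1) (m + 1) ∈ H P m := by
  obtain ⟨x, hx, b, hb, h⟩ := Eg_gam h1 him hn
  exact Submodule.subset_span ⟨x, b, hx, hb, h⟩

variable (P) in
/-- The span of `H P m` and of the `(Yᵢ')^p Xᵢ ⋯ X_m B_m` over the pairs `(i, p)` satisfying `Φ`. -/
def D (m : ℕ) (Φ : ℕ → ℤ → Prop) : Submodule R (Alg P) :=
  Submodule.span R {z | ∃ (i : ℕ) (p : ℤ) (b : Alg P), 1 ≤ i ∧ i ≤ m + 1 ∧ Φ i p ∧ b ∈ Bc P m ∧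
    z = Ypow P i p * gam P i (m + 1) * b} ⊔ H P m

section

variable {m : ℕ} {Φ Ψ : ℕ → ℤ → Prop}

theorem H_le_D : H P m ≤ D P m Φ := le_sup_right

theorem term_mul_mem_D {i : ℕ} {p : ℤ} {b : Alg P} (h1 : 1 ≤ i) (him : i ≤ m + 1) (h : Φ i p)
    (hb : b ∈ Bc P m) : Ypow P i p * gam P i (m + 1) * b ∈ D P m Φ :=
  Submodule.mem_sup_left (Submodule.subset_span ⟨i, p, b, h1, him, h, hb, rfl⟩)

theorem term_mem_D {i : ℕ} {p : ℤ} (h1 : 1 ≤ i) (him : i ≤ m + 1) (h : Φ i p) :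
    Ypow P i p * gam P i (m + 1) ∈ D P m Φ := by
  simpa using term_mul_mem_D (P := P) h1 him h (one_mem _)

theorem D_induction {N : Submodule R (Alg P)} {f : Alg P →ₗ[R] Alg P} {z : Alg P}
    (hz : z ∈ D P m Φ)
    (ht : ∀ (i : ℕ) (p : ℤ) (b : Alg P), 1 ≤ i → i ≤ m + 1 → Φ i p → b ∈ Bc P m →
      f (Ypow P i p * gam P i (m + 1) * b) ∈ N)
    (hH : ∀ z ∈ H P m, f z ∈ N) : f z ∈ N := by
  have : D P m Φ ≤ N.comap f := by
    refine sup_le (Submodule.span_le.2 ?_) hH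
    rintro _ ⟨i, p, b, h1, him, h, hb, rfl⟩
    exact ht i p b h1 him h hb
  exact this hz

theorem D_mul_right {c z : Alg P} (hc : c ∈ Bc P m) (hz : z ∈ D P m Φ) : z * c ∈ D P m Φ := by
  refine D_induction (f := LinearMap.mulRight R c) hz ?_ fun z hz => H_le_D (H_mul_right hc hz)
  intro i p b h1 him h hb
  simpa only [LinearMap.mulRight_apply, mul_assoc (Ypow P i p * gam P i (m + 1))] using
    term_mul_mem_D h1 him h (mul_mem hb hc)

theorem D_mono_of {N : Submodule R (Alg P)} (hN : ∀ z ∈ N, ∀ c ∈ Bc P m, z * c ∈ N)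
    (hH : H P m ≤ N)
    (h : ∀ i p, 1 ≤ i → i ≤ m + 1 → Φ i p → Ypow P i p * gam P i (m + 1) ∈ N) : D P m Φ ≤ N := by
  intro z hz
  refine D_induction (f := LinearMap.id) hz ?_ fun z hz => hH hz
  intro i p b h1 him hΦ hb
  exact hN _ (h i p h1 him hΦ) b hb

theorem D_mono (h : ∀ i p, Φ i p → Ψ i p) : D P m Φ ≤ D P m Ψ :=
  D_mono_of (fun _ hz _ hc => D_mul_right hc hz) H_le_D
    fun i p h1 him hΦ => term_mem_D h1 him (h i p hΦ)

/-- Left multiplication by `c` maps `D P m Φ` to `D P m Ψ` as soon as it does so on the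
spanning elements. -/
theorem D_mul_left {c z : Alg P} (hc : c ∈ Bc P (m + 1)) (hz : z ∈ D P m Φ)
    (h : ∀ i p, 1 ≤ i → i ≤ m + 1 → Φ i p → c * (Ypow P i p * gam P i (m + 1)) ∈ D P m Ψ) :
    c * z ∈ D P m Ψ := by
  refine D_induction (f := LinearMap.mulLeft R c) hz ?_ fun z hz => H_le_D (H_mul_left hc hz)
  intro i p b h1 him hΦ hb
  rw [LinearMap.mulLeft_apply, ← mul_assoc]
  exact D_mul_right hb (h i p h1 him hΦ)

theorem term_comm {c : Alg P} {i : ℕ} (h1 : 1 ≤ i) (him : i ≤ m + 1) (hn : m ≤ P.n - 1)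
    (hn1 : 1 ≤ P.n) (hc : c ∈ Bc P (i - 1)) (p : ℤ) :
    Commute c (Ypow P i p * gam P i (m + 1)) :=
  (Ypow_comm_Bc h1 (by omega) hc p).mul_right
    (commute_gam fun t h1 h2 => (Xg_comm_Bc hc (by omega) (by omega)).symm)

theorem term_comm_succ {c : Alg P} {i : ℕ} (h1 : 1 ≤ i) (him : i ≤ m) (hn : m ≤ P.n - 1)
    (hc : c ∈ Bc P i) (p : ℤ) :
    Commute c (Ypow P (i + 1) p * gam P (i + 1) (m + 1)) :=
  term_comm (by omega) (by omega) hn (by omega) (by rwa [Nat.add_sub_cancel]) p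

theorem gam_comm_succ {c : Alg P} {i : ℕ} (h1 : 1 ≤ i) (him : i ≤ m) (hn : m ≤ P.n - 1)
    (hc : c ∈ Bc P i) : Commute c (gam P (i + 1) (m + 1)) := by
  simpa [Ypow_zero] using term_comm_succ h1 him hn hc 0

theorem Eg_term_mem_H {i : ℕ} (h1 : 1 ≤ i) (him : i ≤ m) (hn : m ≤ P.n - 1) (p : ℤ) :
    Eg P i * (Ypow P (i + 1) p * gam P (i + 1) (m + 1)) ∈ H P m := by
  have hY := Ypow_mem (P := P) h1 le_rfl (-p)
  rw [← mul_assoc, Eg_mul_Ypow_succ h1 (by omega), mul_assoc, (gam_comm_succ h1 him hn hY).eq,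
    ← mul_assoc]
  exact H_mul_right (Bc_mono him hY) (Eg_gam_mem_H h1 him hn)

theorem Eg_term_self_mem_H {i : ℕ} (h1 : 1 ≤ i) (him : i ≤ m) (hn : m ≤ P.n - 1) (p r : ℤ) :
    Eg P i * (Ypow P i p * (Xg P i * (Ypow P (i + 1) r * gam P (i + 1) (m + 1)))) ∈ H P m := by
  have hEm : Eg P i ∈ Bc P (m + 1) := Eg_mem h1 (by omega)
  have hYm (p : ℤ) : Ypow P i p ∈ Bc P (m + 1) := Ypow_mem h1 (by omega) p
  have hid (p r : ℤ) : Eg P i * (Ypow P i p *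
        (Xg P i * (Ypow P (i + 1) (r + 1) * gam P (i + 1) (m + 1)))) =
      Eg P i * (Ypow P i (p + 1) * (Xg P i * (Ypow P (i + 1) r * gam P (i + 1) (m + 1)))) +
      P.delta • (Eg P i * (Ypow P (i + 1) (r + 1) * gam P (i + 1) (m + 1)) * Ypow P i p) -
      P.delta • (Eg P i * (Ypow P i p *
        (Eg P i * (Ypow P (i + 1) (r + 1) * gam P (i + 1) (m + 1))))) := by
    have h := congrArg (Eg P i * Ypow P i p * · * gam P (i + 1) (m + 1))
      (Xg_Ypow_succ (P := P) h1 (by omega) r)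
    have hc := (term_comm_succ (P := P) h1 him hn (Ypow_mem h1 le_rfl p) (r + 1)).eq
    simp only [mul_add, add_mul, mul_sub, sub_mul, smul_mul_assoc, mul_smul_comm, mul_assoc] at h
    rw [h, Ypow_add i p 1, mul_assoc (Eg P i), ← hc]
    simp only [mul_assoc]
  have h2 (p r : ℤ) :
      Eg P i * (Ypow P (i + 1) (r + 1) * gam P (i + 1) (m + 1)) * Ypow P i p ∈ H P m :=
    H_mul_right (Ypow_mem h1 him p) (Eg_term_mem_H h1 him hn _)
  have h3 (p r : ℤ) : Eg P i * (Ypow P i p *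
      (Eg P i * (Ypow P (i + 1) (r + 1) * gam P (i + 1) (m + 1)))) ∈ H P m :=
    H_mul_left hEm (H_mul_left (hYm p) (Eg_term_mem_H h1 him hn _))
  induction p generalizing r with
  | zero =>
    rw [Ypow_zero, one_mul, ← mul_assoc, Eg_mul_Xg h1 (by omega), smul_mul_assoc]
    exact Submodule.smul_mem _ _ (Eg_term_mem_H h1 him hn _)
  | succ p ih =>
    have h := hid p r
    rw [add_sub_assoc] at h
    rw [← sub_eq_of_eq_add h]
    exact sub_mem (ih _) (sub_mem (Submodule.smul_mem _ _ (h2 _ _))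
      (Submodule.smul_mem _ _ (h3 _ _)))
  | pred p ih =>
    obtain ⟨r, rfl⟩ : ∃ r', r = r' + 1 := ⟨r - 1, by ring⟩
    rw [hid, sub_add_cancel]
    exact sub_mem (add_mem (ih _) (Submodule.smul_mem _ _ (h2 _ _)))
      (Submodule.smul_mem _ _ (h3 _ _))

theorem Xg_term_succ_mem_D {i : ℕ} (h1 : 1 ≤ i) (him : i ≤ m) (hn : m ≤ P.n - 1) (p r : ℤ) :
    Ypow P i r * (Xg P i * (Ypow P (i + 1) p * gam P (i + 1) (m + 1))) ∈
      D P m (fun _ _ => True) := by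
  have hid (p r : ℤ) : Ypow P i r *
        (Xg P i * (Ypow P (i + 1) (p + 1) * gam P (i + 1) (m + 1))) =
      Ypow P i (r + 1) * (Xg P i * (Ypow P (i + 1) p * gam P (i + 1) (m + 1))) +
      P.delta • (Ypow P (i + 1) (p + 1) * gam P (i + 1) (m + 1) * Ypow P i r) -
      P.delta • (Ypow P i r *
        (Eg P i * (Ypow P (i + 1) (p + 1) * gam P (i + 1) (m + 1)))) := by
    have h := congrArg (Ypow P i r * · * gam P (i + 1) (m + 1))
      (Xg_Ypow_succ (P := P) h1 (by omega) p)
    have hc := (term_comm_succ (P := P) h1 him hn (Ypow_mem h1 le_rfl r) (p + 1)).eq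
    simp only [mul_add, add_mul, mul_sub, sub_mul, smul_mul_assoc, mul_smul_comm, mul_assoc] at h
    rw [h, Ypow_add i r 1, ← hc]
    simp only [mul_assoc]
  have h2 (p r : ℤ) : Ypow P (i + 1) (p + 1) * gam P (i + 1) (m + 1) * Ypow P i r ∈
      D P m (fun _ _ => True) :=
    term_mul_mem_D (by omega) (by omega) trivial (Ypow_mem h1 him r)
  have h3 (p r : ℤ) : Ypow P i r *
      (Eg P i * (Ypow P (i + 1) (p + 1) * gam P (i + 1) (m + 1))) ∈ D P m (fun _ _ => True) :=
    H_le_D (H_mul_left (Ypow_mem h1 (by omega) r) (Eg_term_mem_H h1 him hn _))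
  induction p generalizing r with
  | zero =>
    rw [Ypow_zero, one_mul, ← gam_cons (by omega)]
    exact term_mem_D h1 (by omega) trivial
  | succ p ih =>
    rw [hid]
    exact sub_mem (add_mem (ih _) (Submodule.smul_mem _ _ (h2 _ _)))
      (Submodule.smul_mem _ _ (h3 _ _))
  | pred p ih =>
    obtain ⟨r, rfl⟩ : ∃ r', r = r' + 1 := ⟨r - 1, by ring⟩
    have h := hid (-p - 1) r
    rw [sub_add_cancel, add_sub_assoc] at h
    rw [← sub_eq_of_eq_add h]
    have h2 := h2 (-p - 1) r
    have h3 := h3 (-p - 1) r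
    rw [sub_add_cancel] at h2 h3
    exact sub_mem (ih _) (sub_mem (Submodule.smul_mem _ _ h2) (Submodule.smul_mem _ _ h3))

/-- Indices at most `i`, together with the exponents in `S` at index `i + 1`. -/
def Below (i : ℕ) (S : ℤ → Prop) (i' : ℕ) (t : ℤ) : Prop := i' ≤ i ∨ (i' = i + 1 ∧ S t)

theorem Ypow_succ_Xg_mem_D {i : ℕ} (h1 : 1 ≤ i) (him : i ≤ m) (hn : m ≤ P.n - 1) (s : ℕ) (q : ℤ) :
    Ypow P i q * (Ypow P (i + 1) s * (Xg P i * gam P (i + 1) (m + 1))) ∈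
      D P m (Below i fun t => 0 ≤ t ∧ t ≤ s) := by
  induction s with
  | zero =>
    rw [Nat.cast_zero, Ypow_zero, one_mul, ← gam_cons (by omega)]
    exact term_mem_D h1 (by omega) (Or.inl le_rfl)
  | succ s ih =>
    have h := congrArg (Ypow P i q * · * gam P (i + 1) (m + 1))
      (Ypow_succ_Xg (P := P) h1 (by omega) s)
    have hc := (term_comm_succ (P := P) h1 him hn (Ypow_mem h1 le_rfl q) (s + 1)).eq
    have hc' := (gam_comm_succ (P := P) h1 him hn (Ypow_mem h1 le_rfl 1)).eq
    simp only [mul_add, add_mul, mul_sub, sub_mul, smul_mul_assoc, mul_smul_comm, mul_assoc] at h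
    push_cast
    rw [h, hc, hc']
    refine sub_mem (add_mem ?_ (Submodule.smul_mem _ _ ?_)) (Submodule.smul_mem _ _ ?_)
    · simp only [← mul_assoc]
      refine D_mul_right (Ypow_mem h1 him 1) ?_
      simp only [mul_assoc]
      exact D_mono (fun i' t h => h.imp_right fun h => ⟨h.1, h.2.1, by omega⟩) ih
    · exact term_mul_mem_D (by omega) (by omega) (Or.inr ⟨rfl, by omega, by omega⟩)
        (Ypow_mem h1 him q)
    · exact H_le_D (H_mul_left (Ypow_mem h1 (by omega) _)
        (H_mul_left (Ypow_mem (by omega) (by omega) _) (Eg_gam_mem_H h1 him hn)))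

theorem Ypow_succ_neg_Xg_mem_D {i : ℕ} (h1 : 1 ≤ i) (him : i ≤ m) (hn : m ≤ P.n - 1) (s : ℕ)
    (q : ℤ) : Ypow P i q * (Ypow P (i + 1) (-s) * (Xg P i * gam P (i + 1) (m + 1))) ∈
      D P m (Below i fun t => -s < t ∧ t ≤ 0) := by
  induction s with
  | zero =>
    rw [Nat.cast_zero, neg_zero, Ypow_zero, one_mul, ← gam_cons (by omega)]
    exact term_mem_D h1 (by omega) (Or.inl le_rfl)
  | succ s ih =>
    have h := congrArg (Ypow P i q * · * gam P (i + 1) (m + 1))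
      (Ypow_sub_one_Xg (P := P) h1 (-s))
    have hc := (term_comm_succ (P := P) h1 him hn (Ypow_mem h1 le_rfl q) (-s)).eq
    have hc' := (gam_comm_succ (P := P) h1 him hn (Ypow_mem h1 le_rfl (-1))).eq
    simp only [mul_assoc] at h
    push_cast
    rw [neg_add, ← sub_eq_add_neg, h, hc', ← mul_assoc, ← mul_assoc, ← mul_assoc]
    refine D_mul_right (Ypow_mem h1 him _) ?_
    rw [Xgi_eq h1 (by omega)]
    simp only [mul_sub, sub_mul, smul_mul_assoc, mul_smul_comm, mul_assoc, mul_one, smul_sub]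
    rw [hc]
    refine sub_mem ?_ (sub_mem (Submodule.smul_mem _ _ ?_) (Submodule.smul_mem _ _ ?_))
    · exact D_mono (fun i' t h => h.imp_right fun h => ⟨h.1, by omega, h.2.2⟩) ih
    · exact term_mul_mem_D (by omega) (by omega) (Or.inr ⟨rfl, by omega, by omega⟩)
        (Ypow_mem h1 him q)
    · exact H_le_D (H_mul_left (Ypow_mem h1 (by omega) _)
        (H_mul_left (Ypow_mem (by omega) (by omega) _) (Eg_gam_mem_H h1 him hn)))

theorem Xg_term_pos {i : ℕ} (h1 : 1 ≤ i) (him : i ≤ m) (hn : m ≤ P.n - 1) (p r : ℕ) :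
    Ypow P (i + 1) r * (Xg P i * (Ypow P i (p + 1) * (Xg P i * gam P (i + 1) (m + 1)))) -
      Ypow P (i + 1) (r + (p + 1)) * gam P (i + 1) (m + 1) ∈
      D P m (Below i fun t => 0 ≤ t ∧ t < r + (p + 1)) := by
  induction p generalizing r with
  | zero =>
    have h : Xg P i * (Ypow P i 1 * (Xg P i * gam P (i + 1) (m + 1))) =
        Ypow P (i + 1) 1 * gam P (i + 1) (m + 1) := by
      rw [Ypow_one, Ypow_one, Yp_succ h1]; simp only [mul_assoc]
    rw [Nat.cast_zero, zero_add, h, ← mul_assoc, ← Ypow_add, sub_self]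
    exact zero_mem _
  | succ p ih =>
    have hi := ih (r + 1)
    have hc : Commute (Ypow P (i + 1) (r + 1)) (Ypow P i (p + 1)) :=
      (Ypow_succ_comm_Bc h1 (by omega) (Ypow_mem h1 le_rfl _) _).symm
    have key : Ypow P (i + 1) r *
          (Xg P i * (Ypow P i ((p + 1 : ℕ) + 1) * (Xg P i * gam P (i + 1) (m + 1)))) =
        Ypow P (i + 1) (r + 1) *
          (Xg P i * (Ypow P i (p + 1) * (Xg P i * gam P (i + 1) (m + 1)))) -
        P.delta • (Ypow P i (p + 1) * (Ypow P (i + 1) (r + 1) *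
          (Xg P i * gam P (i + 1) (m + 1)))) +
        P.delta • (Ypow P (i + 1) (r + 1) *
          (Eg P i * (Ypow P i (p + 1) * (Xg P i * gam P (i + 1) (m + 1))))) := by
      have h := congrArg
        (Ypow P (i + 1) r * · * (Ypow P i (p + 1) * (Xg P i * gam P (i + 1) (m + 1))))
        (Ypow_succ_Xg (P := P) h1 (by omega) 0)
      rw [zero_add, Ypow_zero, one_mul] at h
      simp only [mul_add, add_mul, mul_sub, sub_mul, smul_mul_assoc, mul_smul_comm,
        mul_assoc] at h
      rw [← mul_assoc (Ypow P i (p + 1)) (Ypow P (i + 1) (r + 1)), ← hc.eq,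
        Nat.cast_add, Nat.cast_one, add_comm ((p : ℤ) + 1) 1, Ypow_add i 1,
        Ypow_add (i + 1) r 1]
      simp only [mul_assoc]
      rw [h]
      abel
    have e : (r : ℤ) + ((p + 1 : ℕ) + 1) = (r + 1 : ℕ) + (p + 1) := by push_cast; ring
    rw [key, e, add_sub_right_comm, sub_right_comm]
    push_cast at hi ⊢
    refine add_mem (sub_mem hi (Submodule.smul_mem _ _ ?_)) (Submodule.smul_mem _ _ ?_)
    · have := Ypow_succ_Xg_mem_D (P := P) h1 him hn (r + 1) (p + 1)
      push_cast at this
      exact D_mono (fun i' t h => h.imp_right fun h => ⟨h.1, h.2.1, by omega⟩) this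
    · refine H_le_D (H_mul_left (Ypow_mem (by omega) (by omega) _) ?_)
      have := Eg_term_self_mem_H (P := P) h1 him hn (p + 1) 0
      rwa [Ypow_zero, one_mul] at this

theorem Xg_term_neg {i : ℕ} (h1 : 1 ≤ i) (him : i ≤ m) (hn : m ≤ P.n - 1) (p r : ℕ) :
    Ypow P (i + 1) (-r) * (Xg P i * (Ypow P i (-p) * (Xg P i * gam P (i + 1) (m + 1)))) -
      Ypow P (i + 1) (-r - p) * gam P (i + 1) (m + 1) ∈
      D P m (Below i fun t => -r - p < t ∧ t ≤ 0) := by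
  have hE (r q : ℤ) : Ypow P (i + 1) r *
      (Eg P i * (Ypow P i q * (Xg P i * gam P (i + 1) (m + 1)))) ∈ H P m := by
    refine H_mul_left (Ypow_mem (by omega) (by omega) _) ?_
    have := Eg_term_self_mem_H (P := P) h1 him hn q 0
    rwa [Ypow_zero, one_mul] at this
  induction p generalizing r with
  | zero =>
    have hXX : Xg P i * Xg P i = 1 + P.delta • Xg P i - P.delta • (Eg P i * Xg P i) := by
      have h := congrArg (· * Xg P i) (Xgi_eq (P := P) h1 (by omega))
      simp only [Xgi_mul_Xg, sub_mul, smul_mul_assoc, one_mul] at h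
      rw [h, smul_sub]; abel
    have h := congrArg (Ypow P (i + 1) (-r) * · * gam P (i + 1) (m + 1)) hXX
    simp only [mul_add, add_mul, mul_sub, sub_mul, smul_mul_assoc, mul_smul_comm,
      mul_assoc, one_mul] at h
    have hE := hE (-r) 0
    rw [Nat.cast_zero, neg_zero, Ypow_zero, one_mul, sub_zero, h, add_sub_assoc, add_sub_cancel_left]
    rw [Ypow_zero, one_mul] at hE
    refine sub_mem (Submodule.smul_mem _ _ ?_) (Submodule.smul_mem _ _ (H_le_D hE))
    simpa [Ypow_zero] using Ypow_succ_neg_Xg_mem_D (P := P) h1 him hn r 0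
  | succ p ih =>
    have hi := ih (r + 1)
    have hc : Commute (Ypow P (i + 1) (-r)) (Ypow P i (-p - 1)) :=
      (Ypow_succ_comm_Bc h1 (by omega) (Ypow_mem h1 le_rfl _) _).symm
    have key : Ypow P (i + 1) (-r) *
          (Xg P i * (Ypow P i (-p - 1) * (Xg P i * gam P (i + 1) (m + 1)))) =
        Ypow P (i + 1) (-r - 1) *
          (Xg P i * (Ypow P i (-p) * (Xg P i * gam P (i + 1) (m + 1)))) +
        P.delta • (Ypow P i (-p - 1) * (Ypow P (i + 1) (-r) *
          (Xg P i * gam P (i + 1) (m + 1)))) -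
        P.delta • (Ypow P (i + 1) (-r) *
          (Eg P i * (Ypow P i (-p - 1) * (Xg P i * gam P (i + 1) (m + 1))))) := by
      have h := congrArg (Ypow P (i + 1) (-r) * · * (Xg P i * gam P (i + 1) (m + 1)))
        (Xg_Ypow_sub_one (P := P) h1 (by omega) (-p))
      simp only [mul_add, add_mul, mul_sub, sub_mul, smul_mul_assoc, mul_smul_comm,
        mul_assoc] at h
      rw [h, ← mul_assoc (Ypow P i (-p - 1)) (Ypow P (i + 1) (-r)), ← hc.eq,
        sub_eq_add_neg (-(r : ℤ)), Ypow_add (i + 1)]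
      simp only [mul_assoc]
    push_cast at hi ⊢
    rw [show -((p : ℤ) + 1) = -p - 1 by ring, key,
      show -(r : ℤ) - (p + 1) = -(r + 1) - p by ring, sub_right_comm, add_sub_right_comm]
    rw [show -((r : ℤ) + 1) = -r - 1 by ring] at hi ⊢
    refine sub_mem (add_mem hi (Submodule.smul_mem _ _ ?_))
      (Submodule.smul_mem _ _ (H_le_D (hE _ _)))
    exact D_mono (fun i' t h => h.imp_right fun h => ⟨h.1, by omega, h.2.2⟩)
      (Ypow_succ_neg_Xg_mem_D (P := P) h1 him hn r (-p - 1))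

/-- `t` lies between `0` and `p` and differs from `p`. -/
def Between (p t : ℤ) : Prop := (0 ≤ t ∧ t < p) ∨ (p < t ∧ t ≤ 0)

theorem Xg_term_self {i : ℕ} (h1 : 1 ≤ i) (him : i ≤ m) (hn : m ≤ P.n - 1) (p : ℤ) :
    Xg P i * (Ypow P i p * gam P i (m + 1)) -
      Ypow P (i + 1) p * gam P (i + 1) (m + 1) ∈ D P m (Below i (Between p)) := by
  rw [gam_cons (i := i) (by omega)]
  rcases lt_or_ge 0 p with h | h
  · obtain ⟨q, rfl⟩ : ∃ q : ℕ, p = q + 1 := ⟨(p - 1).toNat, by omega⟩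
    have := Xg_term_pos (P := P) h1 him hn q 0
    rw [Nat.cast_zero, Ypow_zero, one_mul, zero_add] at this
    exact D_mono (fun i' t h => h.imp_right fun h => ⟨h.1, Or.inl h.2⟩) this
  · obtain ⟨q, rfl⟩ : ∃ q : ℕ, p = -q := ⟨(-p).toNat, by omega⟩
    have := Xg_term_neg (P := P) h1 him hn q 0
    rw [Nat.cast_zero, neg_zero, Ypow_zero, one_mul, zero_sub] at this
    exact D_mono (fun i' t h => h.imp_right fun h => ⟨h.1, Or.inr h.2⟩) this

theorem Xg_Eg_term_of_lt {i r : ℕ} (h1 : 1 ≤ i) (hir : i < r) (hrm : r ≤ m) (hn : m ≤ P.n - 1)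
    (p : ℤ) :
    Xg P r * (Ypow P i p * gam P i (m + 1)) = Ypow P i p * gam P i (m + 1) * Xg P (r - 1) ∧
      Eg P r * (Ypow P i p * gam P i (m + 1)) =
        Ypow P i p * gam P i (m + 1) * Eg P (r - 1) := by
  obtain ⟨r, rfl⟩ : ∃ r', r = r' + 1 := ⟨r - 1, by omega⟩
  have hY := Ypow_mem (P := P) h1 (show i ≤ r by omega) p
  obtain ⟨hX, hE⟩ := Xg_gam (P := P) h1 (show i ≤ r by omega) (show r + 2 ≤ m + 1 by omega)
    (by omega)
  constructor
  · rw [← mul_assoc, (Xg_comm_Bc hY le_rfl (by omega)).eq, mul_assoc, hX, mul_assoc,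
      Nat.add_sub_cancel]
  · rw [← mul_assoc, (Eg_comm_Bc hY le_rfl (by omega)).eq, mul_assoc, hE, mul_assoc,
      Nat.add_sub_cancel]

theorem Xg_term_of_lt_mem {i r : ℕ} (h1 : 1 ≤ i) (hir : i < r) (hrm : r ≤ m)
    (hn : m ≤ P.n - 1) {p : ℤ} (hΦ : Φ i p) :
    Xg P r * (Ypow P i p * gam P i (m + 1)) ∈ D P m Φ := by
  rw [(Xg_Eg_term_of_lt h1 hir hrm hn p).1]
  exact term_mul_mem_D h1 (by omega) hΦ (Xg_mem (by omega) (by omega))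

/-- `D P m` is stable under left multiplication by `B_{m+1}`. -/
theorem D_top_mul_left (hn : m ≤ P.n - 1) (hn1 : 1 ≤ P.n) {x z : Alg P} (hx : x ∈ Bc P (m + 1))
    (hz : z ∈ D P m fun _ _ => True) : x * z ∈ D P m fun _ _ => True := by
  have comm {c : Alg P} {i : ℕ} (p : ℤ) (h1 : 1 ≤ i) (him : i ≤ m + 1) (hc : c ∈ Bc P (i - 1)) :
      c * (Ypow P i p * gam P i (m + 1)) ∈ D P m fun _ _ => True := by
    rw [(term_comm h1 him hn hn1 hc p).eq]
    exact term_mul_mem_D h1 him trivial (Bc_mono (by omega) hc)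
  have hY (s : ℤ) (z : Alg P) (hz : z ∈ D P m fun _ _ => True) :
      Ypow P 1 s * z ∈ D P m fun _ _ => True := by
    refine D_mul_left (Ypow_mem le_rfl (by omega) s) hz fun i p h1 him _ => ?_
    rcases (show i = 1 ∨ 2 ≤ i by omega) with rfl | h
    · rw [← mul_assoc, ← Ypow_add]
      exact term_mem_D h1 him trivial
    · exact comm p h1 him (Ypow_mem le_rfl (by omega) s)
  have hX (r : ℕ) (h1r : 1 ≤ r) (hrm : r ≤ m) (z : Alg P) (hz : z ∈ D P m fun _ _ => True) :
      Xg P r * z ∈ D P m fun _ _ => True := by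
    refine D_mul_left (Xg_mem h1r (by omega)) hz fun i p h1 him _ => ?_
    rcases (show r + 1 < i ∨ i = r + 1 ∨ r = i ∨ i < r by omega) with h | rfl | rfl | h
    · exact comm p h1 him (Xg_mem h1r (by omega))
    · simpa [Ypow_zero] using Xg_term_succ_mem_D (P := P) h1r hrm hn p 0
    · have := D_mono (Ψ := fun _ _ => True) (fun _ _ _ => trivial)
        (Xg_term_self (P := P) h1r hrm hn p)
      exact (Submodule.sub_mem_iff_left _
        (term_mem_D (by omega) (by omega) trivial)).1 this
    · exact Xg_term_of_lt_mem h1 h hrm hn trivial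
  have hE (r : ℕ) (h1r : 1 ≤ r) (hrm : r ≤ m) (z : Alg P) (hz : z ∈ D P m fun _ _ => True) :
      Eg P r * z ∈ D P m fun _ _ => True := by
    refine D_mul_left (Eg_mem h1r (by omega)) hz fun i p h1 him _ => ?_
    rcases (show r + 1 < i ∨ i = r + 1 ∨ r = i ∨ i < r by omega) with h | rfl | rfl | h
    · exact comm p h1 him (Eg_mem h1r (by omega))
    · exact H_le_D (Eg_term_mem_H h1r hrm hn p)
    · have := Eg_term_self_mem_H (P := P) h1r hrm hn p 0
      rw [Ypow_zero, one_mul, ← gam_cons (by omega)] at this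
      exact H_le_D this
    · rw [(Xg_Eg_term_of_lt h1 h hrm hn p).2]
      exact term_mul_mem_D h1 (by omega) trivial (Eg_mem (by omega) (by omega))
  refine adjoin_mul_mem ?_ hx hz
  rintro x (⟨-, rfl | rfl⟩ | ⟨r, h1r, hrm, rfl | rfl | rfl⟩) z hz
  · rw [← Ypow_one_one]; exact hY _ z hz
  · rw [← Ypow_one_neg_one]; exact hY _ z hz
  · exact hX r h1r (by omega) z hz
  · rw [Xgi_eq h1r (by omega), sub_mul, smul_mul_assoc, sub_mul, one_mul]
    exact sub_mem (hX r h1r (by omega) z hz)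
      (Submodule.smul_mem _ _ (sub_mem hz (hE r h1r (by omega) z hz)))
  · exact hE r h1r (by omega) z hz

/-- Every element of `B_{m+1}` is a combination of `(Yᵢ')^p Xᵢ ⋯ X_m B_m` and
`B_{m+1} e_m B_m`. -/
theorem Bc_le_D (hn : m ≤ P.n - 1) (hn1 : 1 ≤ P.n) {x : Alg P} (hx : x ∈ Bc P (m + 1)) :
    x ∈ D P m fun _ _ => True := by
  have h1 : (1 : Alg P) ∈ D P m fun _ _ => True := by
    have := term_mem_D (P := P) (m := m) (Φ := fun _ _ => True) (i := m + 1) (p := 0)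
      (by omega) le_rfl trivial
    rwa [Ypow_zero, gam_self, one_mul] at this
  simpa using D_top_mul_left hn hn1 hx h1

/-- The exponents can be restricted to a window `W` around `0`. -/
theorem D_le_window {W : ℤ → Prop} (hW : ∀ p t, W p → Between p t → W t)
    (hWY : ∀ p, Ypow P 1 p ∈ Submodule.span R {z | ∃ s, W s ∧ z = Ypow P 1 s})
    (hn : m ≤ P.n - 1) (i : ℕ) (him : i ≤ m + 1) :
    D P m (fun i' _ => i' ≤ i) ≤ D P m (fun i' p => i' ≤ i ∧ W p) := by
  induction i with
  | zero =>
    refine D_mono_of (fun _ hz _ hc => D_mul_right hc hz) H_le_D fun i' p h1 _ h => ?_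
    omega
  | succ i ih =>
    have ih' : D P m (fun i' _ => i' ≤ i) ≤ D P m (fun i' p => i' ≤ i + 1 ∧ W p) :=
      (ih (by omega)).trans (D_mono fun _ _ h => ⟨by omega, h.2⟩)
    refine D_mono_of (fun _ hz _ hc => D_mul_right hc hz) H_le_D fun i' p h1 him' h => ?_
    rcases (show i' ≤ i ∨ i' = i + 1 by omega) with h' | rfl
    · exact ih' (term_mem_D h1 him' h')
    rcases Nat.eq_zero_or_pos i with rfl | hi
    · refine span_mul_right_mem ?_ (hWY p)
      rintro _ ⟨s, hs, rfl⟩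
      exact term_mem_D le_rfl him ⟨by omega, hs⟩
    have hbelow (S : ℤ → Prop) (hS : ∀ t, S t →
        Ypow P (i + 1) t * gam P (i + 1) (m + 1) ∈ D P m (fun i' p => i' ≤ i + 1 ∧ W p)) :
        D P m (Below i S) ≤ D P m (fun i' p => i' ≤ i + 1 ∧ W p) := by
      refine D_mono_of (fun _ hz _ hc => D_mul_right hc hz) H_le_D ?_
      rintro j t h1 hj (h | ⟨rfl, h⟩)
      · exact ih' (term_mem_D h1 hj h)
      · exact hS t h
    have hself (s : ℤ) : Xg P i * (Ypow P i s * gam P i (m + 1)) -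
      Ypow P (i + 1) s * gam P (i + 1) (m + 1) ∈ D P m (Below i (Between s)) :=
        Xg_term_self hi (by omega) hn s
    have hX : ∀ z ∈ D P m (fun i' p => i' ≤ i ∧ W p),
        Xg P i * z ∈ D P m (fun i' p => i' ≤ i + 1 ∧ W p) := by
      intro z hz
      refine D_mul_left (Xg_mem hi (by omega)) hz fun j s hj hjm h => ?_
      rcases (show j < i ∨ j = i by omega) with hji | rfl
      · exact Xg_term_of_lt_mem hj hji (by omega) hn ⟨by omega, h.2⟩
      · refine (Submodule.sub_mem_iff_left _
          (term_mem_D (i := j + 1) (p := s) (by omega) him ⟨le_rfl, h.2⟩)).1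
          (hbelow _ (fun t ht => ?_) (hself s))
        exact term_mem_D (by omega) him ⟨le_rfl, hW s t h.2 ht⟩
    induction hN : p.natAbs using Nat.strong_induction_on generalizing p with
    | _ N ihN =>
      refine (Submodule.sub_mem_iff_right _
        (hX _ (ih (by omega) (term_mem_D hi (by omega) le_rfl)))).1
        (hbelow _ (fun t ht => ?_) (hself p))
      refine ihN t.natAbs ?_ t rfl
      rcases ht with ht | ht <;> omega

end

end Decomposition

end CBMW

namespace CBMW

section LeftIdeal

variable {R : Type} [CommRing R] {P : Params R}

/-- Any `k` consecutive powers of `Y` that include `1` span all powers of `Y`. -/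
theorem Ypow_one_mem_span (hq0 : P.qc 0 = (P.q0 : R)) {t : ℤ} (ht : t ≤ 0)
    (ht' : 0 ≤ t + P.k - 1) (p : ℤ) :
    Ypow P 1 p ∈
      Submodule.span R {z | ∃ s, (t ≤ s ∧ s ≤ t + P.k - 1) ∧ z = Ypow P 1 s} := by
  set N := Submodule.span R {z | ∃ s, (t ≤ s ∧ s ≤ t + P.k - 1) ∧ z = Ypow P 1 s}
  have hm {s : ℤ} (h : t ≤ s) (h' : s ≤ t + P.k - 1) : Ypow P 1 s ∈ N :=
    Submodule.subset_span ⟨s, ⟨h, h'⟩, rfl⟩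
  have hrel (t : ℤ) : Ypow P 1 (t + P.k) =
      ∑ i ∈ Finset.range P.k, P.qc i • Ypow P 1 (t + i) := by
    simp only [Ypow_add, Ypow_one_natCast, Yg_pow_k, Finset.mul_sum, mul_smul_comm]
  have hup (z : Alg P) (hz : z ∈ N) : Ypow P 1 1 * z ∈ N := by
    refine span_mul_left_mem ?_ hz
    rintro _ ⟨s, ⟨h, h'⟩, rfl⟩
    rw [← Ypow_add]
    rcases (show 1 + s ≤ t + P.k - 1 ∨ 1 + s = t + P.k by omega) with hs | hs
    · exact hm (by omega) hs
    · rw [hs, hrel]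
      refine sum_mem fun i hi => N.smul_mem _ (hm (by omega) ?_)
      have := Finset.mem_range.1 hi
      omega
  have hdown (z : Alg P) (hz : z ∈ N) : Ypow P 1 (-1) * z ∈ N := by
    refine span_mul_left_mem ?_ hz
    rintro _ ⟨s, ⟨h, h'⟩, rfl⟩
    rw [← Ypow_add]
    rcases (show t ≤ -1 + s ∨ -1 + s = t - 1 by omega) with hs | hs
    · exact hm hs (by omega)
    · obtain ⟨k, hk⟩ : ∃ k, P.k = k + 1 := ⟨P.k - 1, by omega⟩
      have h := hrel (t - 1)
      have hle : Ypow P 1 (t - 1 + P.k) ∈ N := hm (by omega) (by omega)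
      rw [h, hk, Finset.sum_range_succ', Submodule.add_mem_iff_right, Nat.cast_zero, add_zero,
        hq0] at hle
      · rw [hs]
        simpa [smul_smul] using N.smul_mem ((P.q0⁻¹ : Rˣ) : R) hle
      · refine sum_mem fun i hi => N.smul_mem _ (hm (by omega) ?_)
        have := Finset.mem_range.1 hi
        omega
  induction p with
  | zero => exact hm ht (by omega)
  | succ p ih => rw [add_comm, Ypow_add]; exact hup _ ih
  | pred p ih => rw [sub_eq_neg_add, Ypow_add]; exact hdown _ ih

variable (P) in
/-- The submodule `B_m e_l`. -/
def BE (m l : ℕ) : Submodule R (Alg P) :=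
  (Subalgebra.toSubmodule (Bc P m)).map (LinearMap.mulRight R (Eg P l))

theorem mul_Eg_mem_BE {m l : ℕ} {x : Alg P} (hx : x ∈ Bc P m) : x * Eg P l ∈ BE P m l :=
  ⟨x, hx, rfl⟩

theorem Eg_mem_BE {m l : ℕ} : Eg P l ∈ BE P m l := by
  simpa using mul_Eg_mem_BE (l := l) (one_mem (Bc P m))

theorem BE_mono {m m' l : ℕ} (h : m ≤ m') : BE P m l ≤ BE P m' l := by
  rintro _ ⟨x, hx, rfl⟩
  exact mul_Eg_mem_BE (Bc_mono h hx)

theorem BE_mul_left {m l : ℕ} {c z : Alg P} (hc : c ∈ Bc P m) (hz : z ∈ BE P m l) :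
    c * z ∈ BE P m l := by
  obtain ⟨x, hx, rfl⟩ := hz
  rw [LinearMap.mulRight_apply, ← mul_assoc]
  exact mul_Eg_mem_BE (mul_mem hc hx)

theorem BE_mul_right {m l : ℕ} {c z : Alg P} (hc : c ∈ Bc P m) (hcE : Commute (Eg P l) c)
    (hz : z ∈ BE P m l) : z * c ∈ BE P m l := by
  obtain ⟨x, hx, rfl⟩ := hz
  rw [LinearMap.mulRight_apply, mul_assoc, hcE.eq, ← mul_assoc]
  exact mul_Eg_mem_BE (mul_mem hx hc)

theorem Eg_Ypow_Eg_one (hq0 : P.qc 0 = (P.q0 : R)) (hk : 1 ≤ P.k) (hn : 1 ≤ P.n - 1) (p : ℤ) :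
    Eg P 1 * (Ypow P 1 p * Eg P 1) ∈ BE P 0 1 := by
  rw [← mul_assoc]
  refine span_mul_left_mem (N := (BE P 0 1).comap (LinearMap.mulRight R (Eg P 1))) ?_
    (Ypow_one_mem_span hq0 le_rfl (by omega) p)
  rintro _ ⟨s, ⟨h, h'⟩, rfl⟩
  lift s to ℕ using h
  rw [Submodule.mem_comap, LinearMap.mulRight_apply, Ypow_one_natCast, EYE hn (by omega)]
  exact Submodule.smul_mem _ _ Eg_mem_BE

variable (P) in
/-- The elements `x` with `e_{i+1} x e_{i+1} ∈ B_i e_{i+1}`. -/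
def Sand (i : ℕ) : Submodule R (Alg P) :=
  (BE P i (i + 1)).comap
    (LinearMap.mulLeft R (Eg P (i + 1)) ∘ₗ LinearMap.mulRight R (Eg P (i + 1)))

theorem mem_Sand {i : ℕ} {x : Alg P} :
    x ∈ Sand P i ↔ Eg P (i + 1) * (x * Eg P (i + 1)) ∈ BE P i (i + 1) := Iff.rfl

theorem Sand_mul_left {i : ℕ} (hn : i + 1 ≤ P.n - 1) {c x : Alg P} (hc : c ∈ Bc P i)
    (hx : x ∈ Sand P i) : c * x ∈ Sand P i := by
  have h := BE_mul_left hc (mem_Sand.1 hx)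
  rw [mem_Sand]
  rwa [← mul_assoc, ← (Eg_comm_Bc hc le_rfl hn).eq, mul_assoc, ← mul_assoc c] at h

theorem Sand_mul_right {i : ℕ} (hn : i + 1 ≤ P.n - 1) {c x : Alg P} (hc : c ∈ Bc P i)
    (hx : x ∈ Sand P i) : x * c ∈ Sand P i := by
  have hcE := Eg_comm_Bc hc le_rfl hn
  have h := BE_mul_right hc hcE (mem_Sand.1 hx)
  rw [mem_Sand]
  simpa only [mul_assoc, hcE.eq] using h

theorem mul_Eg_mem_Sand {i : ℕ} (h1 : 1 ≤ i) (hn : i + 1 ≤ P.n - 1)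
    (hB : ∀ x ∈ Bc P (i + 1), x * Eg P i ∈ BE P i i) {c : Alg P} (hc : c ∈ Bc P (i + 1)) :
    c * Eg P i ∈ Sand P i := by
  obtain ⟨w, hw, h⟩ := hB c hc
  rw [LinearMap.mulRight_apply] at h
  rw [← h]
  refine Sand_mul_left hn hw ?_
  rw [mem_Sand, ← mul_assoc, EEE_down h1 hn]
  exact Eg_mem_BE

theorem Xg_Ypow_Xgi_mem_Sand {i : ℕ} (h1 : 1 ≤ i) (hn : i + 1 ≤ P.n - 1)
    (hB : ∀ x ∈ Bc P (i + 1), x * Eg P i ∈ BE P i i) (p : ℤ) :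
    Xg P i * Ypow P i p * Xgi P i ∈ Sand P i ∧ Eg P i * Ypow P i p * Xgi P i ∈ Sand P i := by
  have hY : Ypow P i p ∈ Bc P (i + 1) := Ypow_mem h1 (by omega) p
  have hb : Commute (Xg P (i + 1)) (Ypow P i p) := Xg_comm_Bc (Ypow_mem h1 le_rfl p) le_rfl hn
  have hb' : Commute (Ypow P i p) (Xgi P (i + 1)) := hb.symm.Xgi_right
  constructor
  · have h := mul_Eg_mem_Sand h1 hn hB (mul_mem (Eg_mem h1 le_rfl) hY)
    rw [mem_Sand] at h ⊢
    convert h using 1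
    calc _ = (Eg P (i + 1) * Xg P i) * Ypow P i p * (Xgi P i * Eg P (i + 1)) := by
          simp only [mul_assoc]
      _ = Eg P (i + 1) * Eg P i * (Ypow P i p * Xgi P (i + 1)) * Xg P (i + 1) * Eg P i *
          Eg P (i + 1) := by
        rw [Eg_succ_mul_Xg h1 hn, Xgi_mul_Eg_succ h1 hn, hb'.eq]; simp only [mul_assoc]
      _ = _ := by
        rw [mul_assoc _ (Ypow P i p * _), mul_assoc (Ypow P i p), Xgi_mul_Xg]
        simp only [mul_assoc, mul_one]
  · have h := mul_Eg_mem_Sand h1 hn hB (mul_mem (Xgi_mem h1 le_rfl) hY)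
    rw [mem_Sand] at h ⊢
    convert h using 1
    calc _ = Eg P (i + 1) * Eg P i * Ypow P i p * (Xgi P i * Eg P (i + 1)) := by
          simp only [mul_assoc]
      _ = Eg P (i + 1) * Eg P i * (Xg P (i + 1) * Ypow P i p) * Eg P i * Eg P (i + 1) := by
        rw [Xgi_mul_Eg_succ h1 hn, hb.eq]; simp only [mul_assoc]
      _ = (Eg P (i + 1) * Eg P i * Xg P (i + 1)) * Ypow P i p * Eg P i * Eg P (i + 1) := by
        simp only [mul_assoc]
      _ = _ := by rw [← Eg_succ_mul_Xgi h1 hn]; simp only [mul_assoc]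

theorem Ypow_succ_mem_Sand {i : ℕ} (h1 : 1 ≤ i) (hn : i + 1 ≤ P.n - 1)
    (hB : ∀ x ∈ Bc P (i + 1), x * Eg P i ∈ BE P i i) (r : ℤ) : Ypow P (i + 1) r ∈ Sand P i := by
  have hzE (r : ℤ) : Ypow P (i + 1) r * Eg P i ∈ Sand P i :=
    mul_Eg_mem_Sand h1 hn hB (Ypow_mem (by omega) le_rfl r)
  have hzEX (r p : ℤ) : Ypow P (i + 1) r * Eg P i * Ypow P i p * Xgi P i ∈ Sand P i := by
    rw [Ypow_succ_mul_Eg h1 (by omega)]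
    simpa only [mul_assoc] using
      Sand_mul_left hn (Ypow_mem h1 le_rfl (-r)) (Xg_Ypow_Xgi_mem_Sand h1 hn hB p).2
  have hid (r p : ℤ) : Ypow P (i + 1) (r + 1) * Xg P i * Ypow P i p * Xgi P i =
      Ypow P (i + 1) r * Xg P i * Ypow P i (p + 1) * Xgi P i +
      P.delta • (Ypow P i p * (Ypow P (i + 1) (r + 1) * Xgi P i)) -
      P.delta • (Ypow P (i + 1) (r + 1) * Eg P i * Ypow P i p * Xgi P i) := by
    have hc := (Ypow_succ_comm_Bc (P := P) h1 (by omega) (Ypow_mem h1 le_rfl p) (r + 1)).eq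
    rw [Ypow_succ_Xg h1 (by omega), add_comm p, Ypow_add i, ← mul_assoc (Ypow P i p), hc]
    simp only [add_mul, sub_mul, smul_mul_assoc, mul_assoc]
  have hz_of {r : ℤ} (h : ∀ p, Ypow P (i + 1) r * Xg P i * Ypow P i p * Xgi P i ∈ Sand P i) :
      Ypow P (i + 1) r ∈ Sand P i := by
    simpa [Ypow_zero, mul_assoc, Xg_mul_Xgi] using h 0
  have main : (∀ p, Ypow P (i + 1) r * Xg P i * Ypow P i p * Xgi P i ∈ Sand P i) ∧
      Ypow P (i + 1) r * Xg P i ∈ Sand P i := by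
    induction r with
    | zero =>
      simp only [Ypow_zero, one_mul]
      refine ⟨fun p => (Xg_Ypow_Xgi_mem_Sand h1 hn hB p).1, ?_⟩
      rw [mem_Sand, ← mul_assoc, Eg_Xg_Eg h1 hn]
      exact Submodule.smul_mem _ _ Eg_mem_BE
    | succ r ih =>
      obtain ⟨ihS, ihU⟩ := ih
      have hU := Sand_mul_right hn (Ypow_mem h1 le_rfl 1) ihU
      have hzX : Ypow P (i + 1) (r + 1) * Xgi P i ∈ Sand P i := by
        rwa [Ypow_add, mul_assoc, ← Xg_mul_Ypow_one h1, ← mul_assoc]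
      have hS (p : ℤ) : Ypow P (i + 1) (r + 1) * Xg P i * Ypow P i p * Xgi P i ∈ Sand P i := by
        rw [hid]
        exact sub_mem (add_mem (ihS _) (Submodule.smul_mem _ _
          (Sand_mul_left hn (Ypow_mem h1 le_rfl p) hzX))) (Submodule.smul_mem _ _ (hzEX _ _))
      refine ⟨hS, ?_⟩
      rw [Ypow_succ_Xg h1 (by omega)]
      exact sub_mem (add_mem hU (Submodule.smul_mem _ _ (hz_of hS)))
        (Submodule.smul_mem _ _ (hzE _))
    | pred r ih =>
      obtain ⟨ihS, ihU⟩ := ih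
      have hzX : Ypow P (i + 1) (-r) * Xgi P i ∈ Sand P i := by
        rw [Xgi_eq h1 (by omega), mul_sub, mul_smul_comm, mul_sub, mul_one]
        exact sub_mem ihU (Submodule.smul_mem _ _ (sub_mem (hz_of ihS) (hzE _)))
      refine ⟨fun p => ?_, ?_⟩
      · have h := hid (-r - 1) (p - 1)
        rw [sub_add_cancel, sub_add_cancel, add_sub_assoc] at h
        rw [← sub_eq_of_eq_add h]
        exact sub_mem (ihS _) (sub_mem (Submodule.smul_mem _ _
          (Sand_mul_left hn (Ypow_mem h1 le_rfl _) hzX)) (Submodule.smul_mem _ _ (hzEX _ _)))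
      · rw [Ypow_sub_one_Xg h1]
        exact Sand_mul_right hn (Ypow_mem h1 le_rfl (-1)) hzX
  exact hz_of main.1

/-- A criterion for `c B_{m+1} e_{m+1} ⊆ B_{m+1} e_{m+1}`. -/
theorem mul_mul_Eg_mem_BE {m : ℕ} (hn : m + 1 ≤ P.n - 1)
    (hB : 1 ≤ m → ∀ x ∈ Bc P (m + 1), x * Eg P m ∈ BE P m m) {c : Alg P}
    (hc : ∀ u ∈ Bc P m, Commute c u)
    (hX : 1 ≤ m → c * (Xg P m * Eg P (m + 1)) ∈ BE P (m + 1) (m + 1))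
    (hE : 1 ≤ m → c * (Eg P m * Eg P (m + 1)) ∈ BE P (m + 1) (m + 1))
    (hY : ∀ p, c * (Ypow P (m + 1) p * Eg P (m + 1)) ∈ BE P (m + 1) (m + 1))
    {x : Alg P} (hx : x ∈ Bc P (m + 1)) :
    c * (x * Eg P (m + 1)) ∈ BE P (m + 1) (m + 1) := by
  have key {u v b : Alg P} (hu : u ∈ Bc P m) (hb : b ∈ Bc P m)
      (hv : c * (v * Eg P (m + 1)) ∈ BE P (m + 1) (m + 1)) :
      c * (u * v * b * Eg P (m + 1)) ∈ BE P (m + 1) (m + 1) := by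
    have hbE := Eg_comm_Bc hb le_rfl hn
    have h := BE_mul_left (Bc_mono (Nat.le_succ m) hu)
      (BE_mul_right (Bc_mono (Nat.le_succ m) hb) hbE hv)
    rw [mul_assoc c, mul_assoc v, hbE.eq, ← mul_assoc u, ← (hc u hu).eq] at h
    simpa only [mul_assoc] using h
  refine D_induction (f := LinearMap.mulLeft R c ∘ₗ LinearMap.mulRight R (Eg P (m + 1)))
    (Bc_le_D (by omega) (by omega) hx) ?_ ?_
  · intro i p b h1 him _ hb
    change c * (Ypow P i p * gam P i (m + 1) * b * Eg P (m + 1)) ∈ _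
    rcases (show i ≤ m ∨ i = m + 1 by omega) with him | rfl
    · rw [gam_snoc him, ← mul_assoc (Ypow P i p)]
      exact key (mul_mem (Ypow_mem h1 him p) (gam_mem h1)) hb (hX (by omega))
    · rw [gam_self, mul_one]
      simpa only [one_mul] using key (one_mem _) hb (hY p)
  · intro z hz
    refine Submodule.span_le (p := (BE P (m + 1) (m + 1)).comap
      (LinearMap.mulLeft R c ∘ₗ LinearMap.mulRight R (Eg P (m + 1)))).2 ?_ hz
    rintro _ ⟨x, b, hx, hb, rfl⟩
    change c * (x * Eg P m * b * Eg P (m + 1)) ∈ BE P (m + 1) (m + 1)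
    rcases Nat.eq_zero_or_pos m with rfl | hm
    · rw [Eg_zero]; simp
    · obtain ⟨x', hx', h⟩ := hB hm x hx
      rw [LinearMap.mulRight_apply] at h
      rw [← h]
      exact key hx' hb (hE hm)

theorem Xg_Ypow_Eg_mem_BE {l : ℕ} (h1 : 1 ≤ l) (hn : l ≤ P.n - 1)
    (hw : ∀ p, Eg P l * (Ypow P l p * Eg P l) ∈ BE P l l) (p : ℤ) :
    Xg P l * (Ypow P l p * Eg P l) ∈ BE P l l := by
  have hz (s : ℤ) (z : Alg P) (hz : z ∈ BE P l l) : Ypow P (l + 1) s * z ∈ BE P l l := by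
    obtain ⟨x, hx, rfl⟩ := hz
    rw [LinearMap.mulRight_apply, ← mul_assoc, ← (Ypow_succ_comm_Bc h1 hn hx s).eq, mul_assoc,
      Ypow_succ_mul_Eg h1 hn]
    exact BE_mul_left hx (mul_Eg_mem_BE (Ypow_mem h1 le_rfl _))
  have hy (p : ℤ) : Ypow P l p * Eg P l ∈ BE P l l := mul_Eg_mem_BE (Ypow_mem h1 le_rfl p)
  have hid (p : ℤ) : Xg P l * (Ypow P l (p - 1) * Eg P l) =
      Ypow P (l + 1) (-1) * (Xg P l * (Ypow P l p * Eg P l)) +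
      (P.delta • (Ypow P l (p - 1) * Eg P l) -
        P.delta • (Eg P l * (Ypow P l (p - 1) * Eg P l))) := by
    rw [← mul_assoc, Xg_Ypow_sub_one h1 hn]
    simp only [add_mul, sub_mul, smul_mul_assoc, mul_assoc, add_sub_assoc]
  induction p with
  | zero =>
    rw [Ypow_zero, one_mul, Xg_mul_Eg h1 hn]
    exact Submodule.smul_mem _ _ Eg_mem_BE
  | succ p ih =>
    have h := hid (p + 1)
    rw [add_sub_cancel_right] at h
    have h' := congrArg (Ypow P (l + 1) 1 * ·) (sub_eq_of_eq_add h)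
    simp only [← mul_assoc (Ypow P (l + 1) 1), Ypow_mul_neg, one_mul] at h'
    rw [← h']
    exact hz _ _ (sub_mem ih (sub_mem (Submodule.smul_mem _ _ (hy _))
      (Submodule.smul_mem _ _ (hw _))))
  | pred p ih =>
    rw [hid]
    exact add_mem (hz _ _ ih) (sub_mem (Submodule.smul_mem _ _ (hy _))
      (Submodule.smul_mem _ _ (hw _)))

/-- `B_{l+1} e_l = B_l e_l`. -/
theorem mul_Eg_mem_BE_of_succ (hq0 : P.qc 0 = (P.q0 : R)) (hk : 1 ≤ P.k) {l : ℕ} (h1 : 1 ≤ l)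
    (hn : l ≤ P.n - 1) {x : Alg P} (hx : x ∈ Bc P (l + 1)) : x * Eg P l ∈ BE P l l := by
  induction l generalizing x with
  | zero => omega
  | succ m ih =>
    have hB (hm : 1 ≤ m) (x : Alg P) (hx : x ∈ Bc P (m + 1)) : x * Eg P m ∈ BE P m m :=
      ih hm (by omega) hx
    have hw (p : ℤ) : Eg P (m + 1) * (Ypow P (m + 1) p * Eg P (m + 1)) ∈
        BE P (m + 1) (m + 1) := by
      refine BE_mono (Nat.le_succ m) ?_
      rcases Nat.eq_zero_or_pos m with rfl | hm
      · exact Eg_Ypow_Eg_one hq0 hk hn p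
      · exact Ypow_succ_mem_Sand hm hn (hB hm) p
    have hE (z : Alg P) (hz : z ∈ BE P (m + 1) (m + 1)) :
        Eg P (m + 1) * z ∈ BE P (m + 1) (m + 1) := by
      obtain ⟨x, hx, rfl⟩ := hz
      refine mul_mul_Eg_mem_BE hn hB (fun u hu => Eg_comm_Bc hu le_rfl hn) ?_ ?_ hw hx
      · intro hm
        rw [← mul_assoc, Eg_Xg_Eg hm hn]
        exact Submodule.smul_mem _ _ Eg_mem_BE
      · intro hm
        rw [← mul_assoc, EEE_down hm hn]
        exact Eg_mem_BE
    have hX (z : Alg P) (hz : z ∈ BE P (m + 1) (m + 1)) :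
        Xg P (m + 1) * z ∈ BE P (m + 1) (m + 1) := by
      obtain ⟨x, hx, rfl⟩ := hz
      refine mul_mul_Eg_mem_BE hn hB (fun u hu => Xg_comm_Bc hu le_rfl hn) ?_ ?_
        (Xg_Ypow_Eg_mem_BE h1 hn hw) hx
      · intro hm
        rw [← mul_assoc, XXE_down hm hn]
        exact mul_Eg_mem_BE (Eg_mem hm le_rfl)
      · intro hm
        rw [← mul_assoc, ← Xgi_mul_Eg_succ hm hn]
        exact mul_Eg_mem_BE (Xgi_mem hm le_rfl)
    refine adjoin_mul_mem ?_ hx Eg_mem_BE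
    rintro x (⟨-, hx⟩ | ⟨i, hi, him, hx⟩) z hz
    · exact BE_mul_left (Algebra.subset_adjoin (Or.inl ⟨h1, hx⟩)) hz
    rcases (show i + 1 ≤ m + 1 ∨ i = m + 1 by omega) with h | rfl
    · exact BE_mul_left (Algebra.subset_adjoin (Or.inr ⟨i, hi, h, hx⟩)) hz
    rcases hx with rfl | rfl | rfl
    · exact hX z hz
    · rw [Xgi_eq hi hn, sub_mul, smul_mul_assoc, sub_mul, one_mul]
      exact sub_mem (hX z hz) (Submodule.smul_mem _ _ (sub_mem hz (hE z hz)))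
    · exact hE z hz

theorem alpha_self {i l : ℕ} (p : ℤ) : alpha P i l l p = Ypow P i p * gam P i l * Eg P l := by
  simp [alpha, gam]

theorem alpha_succ {i j l : ℕ} (h : j ≤ l + 1) (p : ℤ) :
    alpha P i j (l + 1) p = alpha P i j l p * Eg P (l + 1) := by
  rw [alpha, show l + 1 + 1 - j = (l + 1 - j) + 1 by omega, List.range'_concat]
  simp [alpha, mul_assoc, show j + (l + 1 - j) = l + 1 by omega]

variable (P) in
/-- The span of the `α_{ijl}^p B_{l-1}` with `p` satisfying `W`. -/
def J (W : ℤ → Prop) (l : ℕ) : Submodule R (Alg P) :=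
  Submodule.span R {z | ∃ (i j : ℕ) (p : ℤ) (b : Alg P),
    1 ≤ i ∧ i ≤ j ∧ j ≤ l ∧ W p ∧ b ∈ Bc P (l - 1) ∧ z = alpha P i j l p * b}

theorem J_mul_right {W : ℤ → Prop} {l : ℕ} {z c : Alg P} (hc : c ∈ Bc P (l - 1))
    (hz : z ∈ J P W l) : z * c ∈ J P W l := by
  refine span_mul_right_mem ?_ hz
  rintro _ ⟨i, j, p, b, h1, h2, h3, hp, hb, rfl⟩
  rw [mul_assoc]
  exact Submodule.subset_span ⟨i, j, p, b * c, h1, h2, h3, hp, mul_mem hb hc, rfl⟩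

theorem mul_Eg_mem_J (hq0 : P.qc 0 = (P.q0 : R)) (hk : 1 ≤ P.k) {W : ℤ → Prop}
    (hW : ∀ p t, W p → Between p t → W t)
    (hWY : ∀ p, Ypow P 1 p ∈ Submodule.span R {z | ∃ s, W s ∧ z = Ypow P 1 s})
    {l : ℕ} (h1 : 1 ≤ l) (hn : l ≤ P.n - 1) {x : Alg P} (hx : x ∈ Bc P (l + 1)) :
    x * Eg P l ∈ J P W l := by
  induction l generalizing x with
  | zero => omega
  | succ m ih =>
    obtain ⟨x, hx, h⟩ := mul_Eg_mem_BE_of_succ hq0 hk h1 hn hx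
    rw [← h]
    have hD := D_le_window hW hWY (by omega) (m + 1) le_rfl
      (D_mono_of (fun _ hz _ hc => D_mul_right hc hz) H_le_D
        (fun i p h1 him _ => term_mem_D h1 him him) (Bc_le_D (by omega) (by omega) hx))
    have hcomm {b : Alg P} (hb : b ∈ Bc P m) : Commute b (Eg P (m + 1)) :=
      (Eg_comm_Bc hb le_rfl hn).symm
    refine D_induction hD ?_ ?_
    · intro i p b hi him hp hb
      rw [LinearMap.mulRight_apply, mul_assoc, (hcomm hb).eq, ← mul_assoc, ← alpha_self]
      exact Submodule.subset_span ⟨i, m + 1, p, b, hi, him, le_rfl, hp.2, hb, rfl⟩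
    · intro z hz
      refine span_mul_right_mem ?_ hz
      rintro _ ⟨x, b, hx, hb, rfl⟩
      rcases Nat.eq_zero_or_pos m with rfl | hm
      · simp [Eg_zero]
      rw [mul_assoc, (hcomm hb).eq, ← mul_assoc]
      refine J_mul_right hb (span_mul_right_mem ?_ (ih hm (by omega) hx))
      rintro _ ⟨i, j, p, b, hi, hij, hj, hp, hb, rfl⟩
      have hb' : b ∈ Bc P m := Bc_mono (Nat.sub_le m 1) hb
      rw [mul_assoc, (hcomm hb').eq, ← mul_assoc, ← alpha_succ (by omega)]
      exact Submodule.subset_span ⟨i, j, p, b, hi, hij, by omega, hp, hb', rfl⟩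

theorem alpha_mem {i j l : ℕ} (h1 : 1 ≤ i) (hij : i ≤ j) (hj : j ≤ l) (p : ℤ) :
    ∃ v ∈ Bc P (l + 1), alpha P i j l p = v * Eg P l := by
  induction l, hj using Nat.le_induction with
  | base =>
    exact ⟨_, mul_mem (Ypow_mem h1 (by omega) p) (Bc_mono (Nat.le_succ j) (gam_mem h1)),
      alpha_self p⟩
  | succ l hj ih =>
    obtain ⟨v, hv, h⟩ := ih
    refine ⟨v * Eg P l, Bc_mono (Nat.le_succ _) (mul_mem hv (Eg_mem (by omega) le_rfl)), ?_⟩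
    rw [alpha_succ (by omega), h]

end LeftIdeal

end CBMW

/-- Lemma 8 of the paper. For `0 ≤ K < k` and
`P_K = {-K, …, k-K-1}`, the `R`-submodule `L = ⟨α_{ijl}^p B_{l-1} : p ∈ P_K⟩`
is a left ideal of `B_{l+1}`. -/
theorem statement7 {R : Type} [CommRing R] (P : Params R)
    (hn : 1 ≤ P.n) (hk : 1 ≤ P.k) (hq0 : P.qc 0 = (P.q0 : R))
    (hcomp : (P.lam : R) - P.laminv = P.delta * (1 - P.A 0))
    (l : ℕ) (hl1 : 1 ≤ l) (hl : l ≤ P.n - 1)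
    (K : ℤ) (hK0 : 0 ≤ K) (hKk : K < (P.k : ℤ)) :
    ∀ x ∈ Bsub P (l + 1),
      ∀ y ∈ Submodule.span R
          {z : Alg P | ∃ (i j : ℕ) (p : ℤ) (b : Alg P),
            1 ≤ i ∧ i ≤ j ∧ j ≤ l ∧ (-K ≤ p ∧ p ≤ (P.k : ℤ) - K - 1) ∧
            b ∈ Bsub P (l - 1) ∧ z = alpha P i j l p * b},
        x * y ∈ Submodule.span R
          {z : Alg P | ∃ (i j : ℕ) (p : ℤ) (b : Alg P),
            1 ≤ i ∧ i ≤ j ∧ j ≤ l ∧ (-K ≤ p ∧ p ≤ (P.k : ℤ) - K - 1) ∧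
            b ∈ Bsub P (l - 1) ∧ z = alpha P i j l p * b} := by
  intro x hx y hy
  have hx' : x ∈ Bc P (l + 1) := Bsub_le_Bc (by omega) hx
  have hWY : ∀ p, Ypow P 1 p ∈ Submodule.span R
      {z | ∃ s, (-K ≤ s ∧ s ≤ (P.k : ℤ) - K - 1) ∧ z = Ypow P 1 s} := by
    intro p
    convert Ypow_one_mem_span hq0 (t := -K) (by omega) (by omega) p using 8
    omega
  refine span_mul_left_mem ?_ hy
  rintro _ ⟨i, j, p, b, hi, hij, hj, hp, hb, rfl⟩
  obtain ⟨v, hv, hα⟩ := alpha_mem (P := P) hi hij hj p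
  rw [hα, ← mul_assoc, ← mul_assoc]
  refine span_mul_right_mem ?_ (mul_Eg_mem_J hq0 hk (fun p t hp ht => ?_) hWY hl1 hl
    (mul_mem hx' hv))
  · rintro _ ⟨i, j, p, b', hi, hij, hj, hp, hb', rfl⟩
    rw [mul_assoc]
    exact Submodule.subset_span
      ⟨i, j, p, b' * b, hi, hij, hj, hp, mul_mem (Bc_le_Bsub _ hb') hb, rfl⟩
  · rcases ht with ht | ht <;> exact ⟨by omega, by omega⟩
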